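/- arXiv:2104.13811 — 2 statements merged into one kernel-verified Lean document; each statement's English description precedes it below -/
import Mathlib

section
/- Let K be a field, let t, m, n be integers with 1 ≤ t ≤ m ≤ n, let X be a generic m×n matrix over K, and set I = I_t(X) in the polynomial ring K[X]. Then I satisfies G_∞ if and only if one of the following conditions holds: (i) t = 1; (ii) t = m = n; (iii) m = n and t = n−1; (iv) n = m+1 and t = m; (v) n = m+2 and t = m; (vi) m = 2, n = 5, and t = 2. -/
open Matrix

/-- The ideal generated by the `t × t` minors of a matrix. -/
noncomputable def minorsIdeal {R : Type*} [CommRing R] {α β : Type*}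
    (t : ℕ) (A : Matrix α β R) : Ideal R :=
  Ideal.span {d : R | ∃ (f : Fin t → α) (g : Fin t → β),
    Function.Injective f ∧ Function.Injective g ∧ d = (A.submatrix f g).det}

/-- The height of an ideal: the infimum of the heights of primes containing it. -/
noncomputable def idealHeight {R : Type*} [CommRing R] (I : Ideal R) : ℕ∞ :=
  ⨅ p ∈ {p : PrimeSpectrum R | I ≤ p.asIdeal}, Order.height p

/-- The minimal number of generators of an ideal. -/
noncomputable def mu {R : Type*} [CommRing R] (I : Ideal R) : ℕ :=
  sInf {n : ℕ | ∃ s : Finset R, s.card = n ∧ Ideal.span (s : Set R) = I}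

/-- The condition `G_s`. -/
def SatisfiesG {R : Type*} [CommRing R] (I : Ideal R) (s : ℕ) : Prop :=
  ∀ (p : Ideal R) (hp : p.IsPrime), I ≤ p →
    haveI := hp
    ringKrullDim (Localization.AtPrime p) ≤ ((s - 1 : ℕ) : WithBot ℕ∞) →
    (mu (I.map (algebraMap R (Localization.AtPrime p))) : WithBot ℕ∞) ≤
      ringKrullDim (Localization.AtPrime p)

section MinorsIdeal

variable {R : Type*} [CommRing R] {α β γ δ : Type*}

theorem det_submatrix_mem_minorsIdeal (A : Matrix α β R) {k : ℕ} (f : Fin k → α)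
    (g : Fin k → β) : (A.submatrix f g).det ∈ minorsIdeal k A := by
  by_cases hf : Function.Injective f
  · by_cases hg : Function.Injective g
    · exact Ideal.subset_span ⟨f, g, hf, hg, rfl⟩
    · obtain ⟨i, j, hij, hne⟩ := Function.not_injective_iff.mp hg
      rw [Matrix.det_zero_of_column_eq hne (fun l => by simp [hij])]
      exact zero_mem _
  · obtain ⟨i, j, hij, hne⟩ := Function.not_injective_iff.mp hf
    rw [Matrix.det_zero_of_row_eq hne (funext fun l => by simp [hij])]
    exact zero_mem _

theorem minorsIdeal_le_iff {k : ℕ} {A : Matrix α β R} {I : Ideal R} :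
    minorsIdeal k A ≤ I ↔ ∀ (f : Fin k → α) (g : Fin k → β), Function.Injective f →
      Function.Injective g → (A.submatrix f g).det ∈ I := by
  rw [minorsIdeal, Ideal.span_le]
  constructor
  · exact fun h f g hf hg => h ⟨f, g, hf, hg, rfl⟩
  · rintro h _ ⟨f, g, hf, hg, rfl⟩
    exact h f g hf hg

theorem minorsIdeal_submatrix_le (k : ℕ) (A : Matrix α β R) (e : γ → α) (e' : δ → β) :
    minorsIdeal k (A.submatrix e e') ≤ minorsIdeal k A := by
  rw [minorsIdeal_le_iff]
  intro f g _ _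
  rw [Matrix.submatrix_submatrix]
  exact det_submatrix_mem_minorsIdeal A _ _

theorem minorsIdeal_submatrix_equiv (k : ℕ) (A : Matrix α β R) (e : γ ≃ α) (e' : δ ≃ β) :
    minorsIdeal k (A.submatrix e e') = minorsIdeal k A := by
  refine le_antisymm (minorsIdeal_submatrix_le k A e e') ?_
  simpa using minorsIdeal_submatrix_le k (A.submatrix e e') e.symm e'.symm

theorem minorsIdeal_transpose_le (k : ℕ) (A : Matrix α β R) :
    minorsIdeal k Aᵀ ≤ minorsIdeal k A := by
  rw [minorsIdeal_le_iff]
  intro f g _ _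
  rw [← Matrix.det_transpose, Matrix.transpose_submatrix, Matrix.transpose_transpose]
  exact det_submatrix_mem_minorsIdeal A _ _

theorem minorsIdeal_transpose (k : ℕ) (A : Matrix α β R) :
    minorsIdeal k Aᵀ = minorsIdeal k A :=
  le_antisymm (minorsIdeal_transpose_le k A) (by simpa using minorsIdeal_transpose_le k Aᵀ)

theorem minorsIdeal_mul_le_right [Fintype β] (k : ℕ) (P : Matrix α β R) (M : Matrix β γ R) :
    minorsIdeal k (P * M) ≤ minorsIdeal k M := by
  classical
  rw [minorsIdeal_le_iff]
  intro f g _ _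
  have hrows : (P * M).submatrix f g =
      fun i => ∑ l, P (f i) l • (M.submatrix id g) l := by
    ext i j
    simp [Matrix.mul_apply, Finset.sum_apply]
  have hexp : ((P * M).submatrix f g).det =
      ∑ s : Fin k → β, (∏ i, P (f i) (s i)) • (M.submatrix s g).det := by
    rw [hrows]
    change (Matrix.detRowAlternating (R := R) (n := Fin k)).toMultilinearMap _ = _
    rw [MultilinearMap.map_sum]
    refine Finset.sum_congr rfl fun s _ => ?_
    rw [MultilinearMap.map_smul_univ]
    rfl
  rw [hexp]
  exact Ideal.sum_mem _ fun s _ => Ideal.mul_mem_left _ _ (det_submatrix_mem_minorsIdeal M s g)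

theorem minorsIdeal_mul_le_left [Fintype β] (k : ℕ) (M : Matrix α β R) (Q : Matrix β γ R) :
    minorsIdeal k (M * Q) ≤ minorsIdeal k M := by
  rw [← minorsIdeal_transpose k (M * Q), Matrix.transpose_mul, ← minorsIdeal_transpose k M]
  exact minorsIdeal_mul_le_right k _ _

theorem minorsIdeal_le_of_eq_mul [Fintype β] [Fintype γ] (k : ℕ) {M : Matrix α δ R}
    {P : Matrix α β R} {N : Matrix β γ R} {Q : Matrix γ δ R} (h : M = P * N * Q) :
    minorsIdeal k M ≤ minorsIdeal k N :=
  h ▸ (minorsIdeal_mul_le_left k (P * N) Q).trans (minorsIdeal_mul_le_right k P N)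

theorem minorsIdeal_succ_le (k : ℕ) (A : Matrix α β R) :
    minorsIdeal (k + 1) A ≤ minorsIdeal k A := by
  rw [minorsIdeal_le_iff]
  intro f g _ _
  rw [Matrix.det_succ_row_zero]
  refine Ideal.sum_mem _ fun j _ => Ideal.mul_mem_left _ _ ?_
  rw [Matrix.submatrix_submatrix]
  exact det_submatrix_mem_minorsIdeal A _ _

theorem minorsIdeal_antitone (A : Matrix α β R) : Antitone fun k => minorsIdeal k A :=
  antitone_nat_of_succ_le fun k => minorsIdeal_succ_le k A

theorem minorsIdeal_zero (A : Matrix α β R) : minorsIdeal 0 A = ⊤ := by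
  rw [Ideal.eq_top_iff_one]
  simpa using det_submatrix_mem_minorsIdeal A (k := 0) Fin.elim0 Fin.elim0

theorem minorsIdeal_map {S : Type*} [CommRing S] (φ : R →+* S) (k : ℕ) (A : Matrix α β R) :
    (minorsIdeal k A).map φ = minorsIdeal k (A.map φ) := by
  refine le_antisymm ?_ ?_
  · rw [Ideal.map_le_iff_le_comap, minorsIdeal_le_iff]
    intro f g _ _
    rw [Ideal.mem_comap, RingHom.map_det, RingHom.mapMatrix_apply, ← Matrix.submatrix_map]
    exact det_submatrix_mem_minorsIdeal _ f g
  · rw [minorsIdeal_le_iff]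
    intro f g _ _
    rw [Matrix.submatrix_map, ← RingHom.mapMatrix_apply, ← RingHom.map_det]
    exact Ideal.mem_map_of_mem φ (det_submatrix_mem_minorsIdeal A f g)

/-- A minor of a block diagonal matrix whose rows in the first block lie in `s` lies in the ideal
of minors of the second block, of size smaller by `#s`. -/
theorem det_submatrix_fromBlocks_mem [DecidableEq α] (A : Matrix α γ R) (Z : Matrix β δ R) :
    ∀ (k : ℕ) (s : Finset α) (f : Fin k → α ⊕ β) (g : Fin k → γ ⊕ δ),
      Function.Injective f → (∀ i a, f i = Sum.inl a → a ∈ s) →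
      ((Matrix.fromBlocks A 0 0 Z).submatrix f g).det ∈ minorsIdeal (k - s.card) Z := by
  intro k
  induction k with
  | zero =>
    intro s f g _ _
    simp [minorsIdeal_zero]
  | succ k ih =>
    intro s f g hf hs
    by_cases h : ∃ i a, f i = Sum.inl a
    · obtain ⟨i, a, hia⟩ := h
      have ha : a ∈ s := hs i a hia
      rw [Matrix.det_succ_row _ i]
      refine Ideal.sum_mem _ fun j _ => Ideal.mul_mem_left _ _ ?_
      rw [Matrix.submatrix_submatrix]
      have hcard : k + 1 - s.card = k - (s.erase a).card := by
        rw [Finset.card_erase_of_mem ha]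
        have := Finset.card_pos.mpr ⟨a, ha⟩
        omega
      rw [hcard]
      refine ih (s.erase a) _ _ (hf.comp Fin.succAbove_right_injective) ?_
      intro l b hb
      refine Finset.mem_erase.mpr ⟨?_, hs _ b hb⟩
      rintro rfl
      exact Fin.succAbove_ne i l (hf (hb.trans hia.symm))
    · have hf' : ∀ i, ∃ b, f i = Sum.inr b := fun i => by
        cases hfi : f i with
        | inl a => exact absurd ⟨i, a, hfi⟩ h
        | inr b => exact ⟨b, rfl⟩
      choose f' hf' using hf'
      by_cases h' : ∃ j c, g j = Sum.inl c
      · obtain ⟨j, c, hj⟩ := h'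
        rw [Matrix.det_eq_zero_of_column_eq_zero j (fun i => by simp [hj, hf'])]
        exact zero_mem _
      · have hg' : ∀ i, ∃ b, g i = Sum.inr b := fun i => by
          cases hgi : g i with
          | inl a => exact absurd ⟨i, a, hgi⟩ h'
          | inr b => exact ⟨b, rfl⟩
        choose g' hg' using hg'
        have hsub : (Matrix.fromBlocks A 0 0 Z).submatrix f g = Z.submatrix f' g' := by
          ext i j
          simp [hf', hg']
        rw [hsub]
        exact minorsIdeal_antitone Z (Nat.sub_le _ _) (det_submatrix_mem_minorsIdeal Z f' g')

theorem minorsIdeal_fromBlocks_diagonal {r k : ℕ} (A : Matrix (Fin r) (Fin r) R)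
    (hA : IsUnit A.det) (Z : Matrix β δ R) :
    minorsIdeal (r + k) (Matrix.fromBlocks A 0 0 Z) = minorsIdeal k Z := by
  refine le_antisymm ?_ ?_
  · rw [minorsIdeal_le_iff]
    intro f g hf _
    simpa using det_submatrix_fromBlocks_mem A Z (r + k) Finset.univ f g hf (by simp)
  · rw [minorsIdeal_le_iff]
    intro f g _ _
    have hdet : (((Matrix.fromBlocks A 0 0 Z).submatrix
        (Sum.map id f ∘ finSumFinEquiv.symm) (Sum.map id g ∘ finSumFinEquiv.symm)).det) =
        A.det * (Z.submatrix f g).det := by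
      rw [← Matrix.submatrix_submatrix, Matrix.det_submatrix_equiv_self,
        ← Matrix.det_fromBlocks_zero₂₁ A 0]
      congr 1
      ext (i | i) (j | j) <;> simp
    rw [← Ideal.unit_mul_mem_iff_mem _ hA, ← hdet]
    exact det_submatrix_mem_minorsIdeal _ _ _

/-- Minors of a block matrix with invertible corner are governed by its Schur complement. -/
theorem minorsIdeal_fromBlocks [Fintype β] [Fintype δ] [DecidableEq β] [DecidableEq δ]
    {r k : ℕ} (A : Matrix (Fin r) (Fin r) R)
    (hA : IsUnit A.det) (B : Matrix (Fin r) δ R) (C : Matrix β (Fin r) R) (D : Matrix β δ R) :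
    minorsIdeal (r + k) (Matrix.fromBlocks A B C D) = minorsIdeal k (D - C * A⁻¹ * B) := by
  have hAA := Matrix.mul_nonsing_inv A hA
  have hAA' := Matrix.nonsing_inv_mul A hA
  rw [← minorsIdeal_fromBlocks_diagonal A hA (D - C * A⁻¹ * B)]
  refine le_antisymm ?_ ?_
  · have h : Matrix.fromBlocks A B C D = Matrix.fromBlocks (1 : Matrix (Fin r) (Fin r) R) 0
        (C * A⁻¹) (1 : Matrix β β R) *
        Matrix.fromBlocks A 0 0 (D - C * A⁻¹ * B) *
        Matrix.fromBlocks 1 (A⁻¹ * B) 0 (1 : Matrix δ δ R) := by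
      simp [Matrix.fromBlocks_multiply, Matrix.mul_assoc, hAA']
      rw [← Matrix.mul_assoc, hAA, Matrix.one_mul]
    exact minorsIdeal_le_of_eq_mul _ h
  · have h : Matrix.fromBlocks A 0 0 (D - C * A⁻¹ * B) = Matrix.fromBlocks
        (1 : Matrix (Fin r) (Fin r) R) 0 (-(C * A⁻¹)) (1 : Matrix β β R) *
        Matrix.fromBlocks A B C D *
        Matrix.fromBlocks 1 (-(A⁻¹ * B)) 0 (1 : Matrix δ δ R) := by
      simp [Matrix.fromBlocks_multiply, Matrix.mul_assoc, hAA', ← sub_eq_neg_add]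
      rw [← Matrix.mul_assoc, hAA, Matrix.one_mul]
      simp
    exact minorsIdeal_le_of_eq_mul _ h

end MinorsIdeal

section Generators

variable {R : Type*} [CommRing R]

theorem mu_le_card {ι : Type*} [Fintype ι] {I : Ideal R} (v : ι → R)
    (hv : Ideal.span (Set.range v) = I) : mu I ≤ Fintype.card ι := by
  classical
  have h : mu I ≤ (Finset.univ.image v).card :=
    Nat.sInf_le ⟨Finset.univ.image v, rfl, by simpa using hv⟩
  exact h.trans Finset.card_image_le

theorem exists_finset_card_eq_mu {I : Ideal R} (hI : I.FG) :
    ∃ s : Finset R, s.card = mu I ∧ Ideal.span (s : Set R) = I :=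
  Nat.sInf_mem (s := {n : ℕ | ∃ s : Finset R, s.card = n ∧ Ideal.span (s : Set R) = I})
    (let ⟨s, hs⟩ := hI; ⟨s.card, s, rfl, hs⟩)

/-- The `k`-element subsets of `Fin a`. -/
abbrev KSubset (a k : ℕ) : Type :=
  {s : Finset (Fin a) // s ∈ Finset.powersetCard k (Finset.univ : Finset (Fin a))}

theorem KSubset.card_eq {a k : ℕ} (s : KSubset a k) : s.1.card = k :=
  (Finset.mem_powersetCard.mp s.2).2

theorem card_kSubset (a k : ℕ) : Fintype.card (KSubset a k) = a.choose k := by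
  simp [KSubset]

/-- The increasing enumeration of a `k`-element subset of `Fin a`. -/
def KSubset.enum {a k : ℕ} (s : KSubset a k) : Fin k ↪o Fin a :=
  s.1.orderEmbOfFin s.card_eq

theorem KSubset.range_enum {a k : ℕ} (s : KSubset a k) : Set.range s.enum = (s.1 : Set (Fin a)) :=
  Finset.range_orderEmbOfFin _ _

theorem KSubset.exists_enum_comp_perm {a k : ℕ} (f : Fin k → Fin a) (hf : Function.Injective f) :
    ∃ (s : KSubset a k) (σ : Equiv.Perm (Fin k)), f = s.enum ∘ σ := by
  classical
  let s : KSubset a k := ⟨Finset.univ.image f, by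
    simp [Finset.mem_powersetCard, Finset.card_image_of_injective _ hf]⟩
  have hmem : ∀ i, ∃ j, s.enum j = f i := fun i => by
    rw [← Set.mem_range, s.range_enum]
    simp [s]
  choose σ hσ using hmem
  have hinj : Function.Injective σ := fun i j hij => hf (by rw [← hσ, ← hσ, hij])
  refine ⟨s, Equiv.ofBijective σ (Finite.injective_iff_bijective.mp hinj), ?_⟩
  funext i
  simp [hσ]

theorem span_range_minors {a b : ℕ} (k : ℕ) (Z : Matrix (Fin a) (Fin b) R) :
    Ideal.span (Set.range fun s : KSubset a k × KSubset b k =>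
      (Z.submatrix s.1.enum s.2.enum).det) = minorsIdeal k Z := by
  refine le_antisymm ?_ ?_
  · rw [Ideal.span_le]
    rintro _ ⟨s, rfl⟩
    exact det_submatrix_mem_minorsIdeal Z _ _
  · rw [minorsIdeal_le_iff]
    intro f g hf hg
    obtain ⟨s, σ, rfl⟩ := KSubset.exists_enum_comp_perm f hf
    obtain ⟨s', τ, rfl⟩ := KSubset.exists_enum_comp_perm g hg
    have h : Z.submatrix (s.enum ∘ σ) (s'.enum ∘ τ) =
        ((Z.submatrix s.enum s'.enum).submatrix σ id).submatrix id τ := rfl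
    rw [h, Matrix.det_permute', Matrix.det_permute]
    exact Ideal.mul_mem_left _ _ (Ideal.mul_mem_left _ _ (Ideal.subset_span ⟨(s, s'), rfl⟩))

theorem mu_minorsIdeal_le {a b : ℕ} (k : ℕ) (Z : Matrix (Fin a) (Fin b) R) :
    mu (minorsIdeal k Z) ≤ a.choose k * b.choose k := by
  refine (mu_le_card _ (span_range_minors k Z)).trans ?_
  rw [Fintype.card_prod, card_kSubset, card_kSubset]

end Generators

section PowerSeries

variable {σ L : Type*} [Field L]

theorem MvPowerSeries.coeff_mul_of_coeff_eq_zero {t : ℕ} {g : MvPowerSeries σ L}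
    (hg : ∀ d : σ →₀ ℕ, d.degree < t → MvPowerSeries.coeff d g = 0) (a : MvPowerSeries σ L)
    {d : σ →₀ ℕ} (hd : d.degree ≤ t) :
    MvPowerSeries.coeff d (a * g) =
      MvPowerSeries.constantCoeff a * MvPowerSeries.coeff d g := by
  classical
  rw [MvPowerSeries.coeff_mul, Finset.sum_eq_single (0, d)]
  · simp
  · rintro ⟨x, y⟩ hxy hne
    rw [Finset.HasAntidiagonal.mem_antidiagonal] at hxy
    have hx : x.degree ≠ 0 := by
      rw [Ne, Finsupp.degree_eq_zero_iff]
      rintro rfl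
      exact hne (by simpa using hxy)
    have hdeg : x.degree + y.degree = d.degree := by
      rw [← hxy, map_add]
    rw [hg y (by omega), mul_zero]
  · simp

/-- Power series of order at least `t` whose degree `t` parts are separated by coefficients form a
minimal system of generators. -/
theorem card_le_card_of_span_eq {ι : Type*} [Fintype ι] [DecidableEq ι] {t : ℕ}
    (v : ι → MvPowerSeries σ L) (d : ι → σ →₀ ℕ) (hd : ∀ i, (d i).degree = t)
    (hv : ∀ i e, e.degree < t → MvPowerSeries.coeff e (v i) = 0)
    (hvd : ∀ i j, MvPowerSeries.coeff (d i) (v j) = if i = j then 1 else 0)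
    (S : Finset (MvPowerSeries σ L))
    (hS : Ideal.span (S : Set (MvPowerSeries σ L)) = Ideal.span (Set.range v)) :
    Fintype.card ι ≤ S.card := by
  have horder : ∀ g ∈ Ideal.span (Set.range v), ∀ e : σ →₀ ℕ, e.degree < t →
      MvPowerSeries.coeff e g = 0 := by
    intro g hg
    induction hg using Submodule.span_induction with
    | mem x hx =>
      obtain ⟨i, rfl⟩ := hx
      exact hv i
    | zero => simp
    | add x y _ _ hx hy =>
      intro e he
      rw [map_add, hx e he, hy e he, add_zero]
    | smul a x _ hx =>
      intro e he
      rw [smul_eq_mul, MvPowerSeries.coeff_mul_of_coeff_eq_zero hx a he.le, hx e he, mul_zero]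
  have hmem : ∀ j, ∃ c : MvPowerSeries σ L → MvPowerSeries σ L, ∑ g ∈ S, c g * g = v j := by
    intro j
    have hj : v j ∈ Ideal.span (S : Set (MvPowerSeries σ L)) :=
      hS ▸ Ideal.subset_span ⟨j, rfl⟩
    obtain ⟨c, -, hc⟩ := Submodule.mem_span_finset.mp hj
    exact ⟨c, hc⟩
  choose c hc using hmem
  let A : Matrix ι S L := Matrix.of fun j g => MvPowerSeries.constantCoeff (c j g)
  let B : Matrix S ι L := Matrix.of fun g i => MvPowerSeries.coeff (d i) (g : MvPowerSeries σ L)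
  have hAB : A * B = 1 := by
    ext j i
    rw [Matrix.mul_apply, Matrix.one_apply]
    have h := hvd i j
    rw [← hc j, map_sum, ← Finset.sum_coe_sort] at h
    simp only [eq_comm (a := j), ← h]
    refine Finset.sum_congr rfl fun g _ => ?_
    rw [MvPowerSeries.coeff_mul_of_coeff_eq_zero
      (horder g (hS ▸ Ideal.subset_span g.2)) _ (hd i).le]
    rfl
  have hrank := (Matrix.rank_mul_le_left A B).trans (Matrix.rank_le_card_width A)
  rw [hAB, Matrix.rank_one] at hrank
  simpa using hrank

end PowerSeries

section GenericMinors

variable {L : Type*} [Field L] {m n t : ℕ}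

/-- The exponent of the diagonal term of a minor of a generic matrix. -/
noncomputable def diagonalExponent (s : KSubset m t × KSubset n t) : Fin m × Fin n →₀ ℕ :=
  ∑ i, Finsupp.single (s.1.enum i, s.2.enum i) 1

theorem sum_single_degree {ι : Type*} (f : Fin t → ι) :
    (∑ i, Finsupp.single (f i) 1 : ι →₀ ℕ).degree = t := by
  rw [map_sum]
  simp

theorem mem_support_sum_single {ι : Type*} (f : Fin t → ι) (x : ι) :
    x ∈ (∑ i, Finsupp.single (f i) 1 : ι →₀ ℕ).support ↔ ∃ i, f i = x := by
  classical
  simp [Finsupp.finsetSum_apply, Finsupp.single_apply]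

theorem diagonalExponent_eq_iff (s s' : KSubset m t × KSubset n t) (σ : Equiv.Perm (Fin t)) :
    (∑ i, Finsupp.single (s'.1.enum (σ i), s'.2.enum i) 1 : Fin m × Fin n →₀ ℕ) =
      diagonalExponent s ↔ s = s' ∧ σ = 1 := by
  constructor
  · intro h
    have key : ∀ x, (∃ i, (s'.1.enum (σ i), s'.2.enum i) = x) ↔
        ∃ i, (s.1.enum i, s.2.enum i) = x := by
      intro x
      rw [← mem_support_sum_single (fun i => (s'.1.enum (σ i), s'.2.enum i)),
        ← mem_support_sum_single (fun i => (s.1.enum i, s.2.enum i)), h]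
      rfl
    have h1 : s.1 = s'.1 := by
      apply Subtype.ext
      rw [← Finset.coe_inj, ← KSubset.range_enum, ← KSubset.range_enum]
      ext x
      constructor
      · rintro ⟨i, rfl⟩
        obtain ⟨j, hj⟩ := (key _).mpr ⟨i, rfl⟩
        exact ⟨σ j, congrArg Prod.fst hj⟩
      · rintro ⟨i, rfl⟩
        obtain ⟨j, hj⟩ := (key _).mp ⟨σ.symm i, rfl⟩
        exact ⟨j, by simpa using congrArg Prod.fst hj⟩
    have h2 : s.2 = s'.2 := by
      apply Subtype.ext
      rw [← Finset.coe_inj, ← KSubset.range_enum, ← KSubset.range_enum]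
      ext x
      constructor
      · rintro ⟨i, rfl⟩
        obtain ⟨j, hj⟩ := (key _).mpr ⟨i, rfl⟩
        exact ⟨j, congrArg Prod.snd hj⟩
      · rintro ⟨i, rfl⟩
        obtain ⟨j, hj⟩ := (key _).mp ⟨i, rfl⟩
        exact ⟨j, congrArg Prod.snd hj⟩
    refine ⟨Prod.ext h1 h2, Equiv.ext fun i => ?_⟩
    obtain ⟨j, hj⟩ := (key _).mp ⟨i, rfl⟩
    rw [h1, h2, Prod.mk.injEq, EmbeddingLike.apply_eq_iff_eq, EmbeddingLike.apply_eq_iff_eq] at hj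
    rw [← hj.1, hj.2]
    rfl
  · rintro ⟨rfl, rfl⟩
    rfl

theorem det_submatrix_generic (f : Fin t → Fin m) (g : Fin t → Fin n) :
    ((Matrix.of fun i j => (MvPolynomial.X (i, j) : MvPolynomial (Fin m × Fin n) L)).submatrix
      f g).det = ∑ σ : Equiv.Perm (Fin t), MvPolynomial.monomial
        (∑ i, Finsupp.single (f (σ i), g i) 1) ((Equiv.Perm.sign σ : ℤ) : L) := by
  rw [Matrix.det_apply']
  refine Finset.sum_congr rfl fun σ _ => ?_
  rw [MvPolynomial.monomial_sum_index, map_intCast]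
  rfl

theorem coeff_det_generic (s s' : KSubset m t × KSubset n t) :
    MvPolynomial.coeff (diagonalExponent s)
      ((Matrix.of fun i j => (MvPolynomial.X (i, j) : MvPolynomial (Fin m × Fin n) L)).submatrix
        s'.1.enum s'.2.enum).det = if s = s' then 1 else 0 := by
  rw [det_submatrix_generic, MvPolynomial.coeff_sum]
  simp only [MvPolynomial.coeff_monomial, diagonalExponent_eq_iff]
  by_cases h : s = s'
  · simp [h]
  · simp [h]

theorem coeff_det_generic_of_degree_lt (f : Fin t → Fin m) (g : Fin t → Fin n)
    {e : Fin m × Fin n →₀ ℕ} (he : e.degree < t) :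
    MvPolynomial.coeff e
      ((Matrix.of fun i j => (MvPolynomial.X (i, j) : MvPolynomial (Fin m × Fin n) L)).submatrix
        f g).det = 0 := by
  rw [det_submatrix_generic, MvPolynomial.coeff_sum]
  refine Finset.sum_eq_zero fun σ _ => ?_
  rw [MvPolynomial.coeff_monomial, if_neg]
  rintro rfl
  rw [sum_single_degree] at he
  exact lt_irrefl _ he

/-- At the origin the `t`-minors of a generic matrix form a minimal system of generators. -/
theorem choose_mul_choose_le_mu (p : Ideal (MvPolynomial (Fin m × Fin n) L)) [p.IsPrime]
    (hp : RingHom.ker MvPolynomial.constantCoeff ≤ p) :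
    m.choose t * n.choose t ≤ mu ((minorsIdeal t (Matrix.of fun i j =>
      (MvPolynomial.X (i, j) : MvPolynomial (Fin m × Fin n) L))).map
        (algebraMap _ (Localization.AtPrime p))) := by
  classical
  set X : Matrix (Fin m) (Fin n) (MvPolynomial (Fin m × Fin n) L) :=
    Matrix.of fun i j => MvPolynomial.X (i, j) with hX
  let ψ : MvPolynomial (Fin m × Fin n) L →+* MvPowerSeries (Fin m × Fin n) L :=
    MvPolynomial.coeToMvPowerSeries.ringHom
  have hψ : ∀ y : p.primeCompl, IsUnit (ψ y) := by
    intro y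
    rw [MvPowerSeries.isUnit_iff_constantCoeff, isUnit_iff_ne_zero]
    intro h
    refine y.2 (hp ?_)
    rw [RingHom.mem_ker, MvPolynomial.constantCoeff_eq]
    exact (MvPolynomial.coeff_coe _ _).symm.trans h
  let φ : Localization.AtPrime p →+* MvPowerSeries (Fin m × Fin n) L := IsLocalization.lift hψ
  have hφ : φ.comp (algebraMap _ _) = ψ := IsLocalization.lift_comp hψ
  obtain ⟨S, hScard, hS⟩ := exists_finset_card_eq_mu
    (I := (minorsIdeal t X).map (algebraMap _ (Localization.AtPrime p)))
    (IsNoetherian.noetherian _)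
  rw [← hScard]
  have hspan : Ideal.span ((S.image φ : Finset _) : Set (MvPowerSeries (Fin m × Fin n) L)) =
      Ideal.span (Set.range fun s : KSubset m t × KSubset n t =>
        ψ (X.submatrix s.1.enum s.2.enum).det) := by
    rw [Finset.coe_image, ← Ideal.map_span, hS, Ideal.map_map, hφ, ← span_range_minors,
      Ideal.map_span, ← Set.range_comp]
    rfl
  have h := card_le_card_of_span_eq (t := t) _ diagonalExponent
    (fun s => sum_single_degree _)
    (fun s e he => (MvPolynomial.coeff_coe _ _).trans (coeff_det_generic_of_degree_lt _ _ he))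
    (fun s s' => (MvPolynomial.coeff_coe _ _).trans (coeff_det_generic s s')) _ hspan
  rw [Fintype.card_prod, card_kSubset, card_kSubset] at h
  exact h.trans Finset.card_image_le

end GenericMinors

section Height

theorem card_le_height {R S ι : Type*} [CommRing R] [CommRing S] [IsDomain S] [Fintype ι]
    (φ : R →+* MvPolynomial ι S) (x : ι → R) (u : ι → S) (hu : ∀ i, u i ≠ 0)
    (hx : ∀ i, φ (x i) = MvPolynomial.C (u i) * MvPolynomial.X i) (p : Ideal R) [p.IsPrime]
    (hp : ∀ f, MvPolynomial.constantCoeff (φ f) = 0 → f ∈ p) :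
    (Fintype.card ι : ℕ∞) ≤ p.height := by
  classical
  let ev : Finset ι → MvPolynomial ι S →ₐ[S] MvPolynomial ι S := fun s =>
    MvPolynomial.aeval fun i => if i ∈ s then 0 else MvPolynomial.X i
  let Q : Finset ι → Ideal R := fun s => RingHom.ker ((ev s).toRingHom.comp φ)
  have hQ : ∀ s, (Q s).IsPrime := fun s => RingHom.ker_isPrime _
  have hmem : ∀ s f, f ∈ Q s ↔ ev s (φ f) = 0 := fun s f => Iff.rfl
  have hmono : ∀ s s', s ⊆ s' → Q s ≤ Q s' := by
    intro s s' hss f hf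
    have hcomp : (ev s').comp (ev s) = ev s' := by
      refine MvPolynomial.algHom_ext fun i => ?_
      by_cases h : i ∈ s
      · simp [ev, h, hss h]
      · simp [ev, h]
    rw [hmem] at hf ⊢
    rw [← hcomp, AlgHom.comp_apply, hf, map_zero]
  have hcard : ∀ s : Finset ι, (s.card : ℕ∞) ≤ (Q s).height := by
    intro s
    induction s using Finset.induction_on with
    | empty => simp
    | insert i s hi ih =>
      have hlt : Q s < Q (insert i s) := by
        refine lt_of_le_of_ne (hmono _ _ (Finset.subset_insert i s)) fun heq => ?_
        have hxi : x i ∈ Q (insert i s) := by simp [hmem, hx, ev]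
        rw [← heq, hmem] at hxi
        simp [hx, ev, hi, hu] at hxi
      rw [Finset.card_insert_of_notMem hi, Nat.cast_add, Nat.cast_one]
      have := hQ s
      have := hQ (insert i s)
      exact (add_le_add_left ih 1).trans (Ideal.height_add_one_le_of_lt_of_isPrime hlt)
  refine (hcard Finset.univ).trans (Ideal.height_mono fun f hf => hp f ?_)
  rw [hmem] at hf
  have hev : ev Finset.univ = (Algebra.ofId S _).comp (MvPolynomial.aeval 0) := by
    refine MvPolynomial.algHom_ext fun i => ?_
    simp [ev]
  rw [hev] at hf
  have hf' : MvPolynomial.C (MvPolynomial.constantCoeff (φ f)) = (0 : MvPolynomial ι S) := by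
    simpa [Algebra.ofId_apply, MvPolynomial.algebraMap_eq] using hf
  simpa using hf'

end Height

theorem exists_equiv_sum_of_injective {r m : ℕ} (f : Fin r → Fin m) (hf : Function.Injective f) :
    ∃ σ : Fin r ⊕ Fin (m - r) ≃ Fin m, ∀ i, σ (Sum.inl i) = f i := by
  classical
  have hcard : Fintype.card ((Set.range f)ᶜ : Set (Fin m)) = Fintype.card (Fin (m - r)) := by
    rw [Fintype.card_compl_set, Set.card_range_of_injective hf]
    simp
  refine ⟨((Equiv.ofInjective f hf).sumCongr (Fintype.equivOfCardEq hcard).symm).trans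
    (Equiv.Set.sumCompl (Set.range f)), fun i => ?_⟩
  simp

section Generic

variable {K : Type*} [Field K] {m n : ℕ}

/-- A bordered determinant equals the determinant of the corner times the Schur complement. -/
theorem det_fromBlocks_of_mul_eq_one {R : Type*} [CommRing R] {r : ℕ}
    (A G : Matrix (Fin r) (Fin r) R) (hAG : A * G = 1) {ι : Type*} [Fintype ι] [DecidableEq ι]
    (B : Matrix (Fin r) ι R) (C : Matrix ι (Fin r) R) (D : Matrix ι ι R) :
    (Matrix.fromBlocks A B C D).det = A.det * (D - C * G * B).det := by
  let _ : Invertible A := ⟨G, mul_eq_one_comm.mp hAG, hAG⟩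
  exact Matrix.det_fromBlocks₁₁ A B C D

/-- The minor on the rows of the first block together with `i` and the columns of the first block
together with `j`. -/
noncomputable def borderedMinor {R α β ρ κ : Type*} [CommRing R] {r : ℕ} (M : Matrix α β R)
    (σ : Fin r ⊕ ρ → α) (τ : Fin r ⊕ κ → β) (i : ρ) (j : κ) : R :=
  (M.submatrix (σ ∘ Sum.map id fun _ : Fin 1 => i) (τ ∘ Sum.map id fun _ : Fin 1 => j)).det

theorem borderedMinor_mem {R α β ρ κ : Type*} [CommRing R] {r : ℕ} (M : Matrix α β R)
    (σ : Fin r ⊕ ρ → α) (τ : Fin r ⊕ κ → β) (i : ρ) (j : κ) :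
    borderedMinor M σ τ i j ∈ minorsIdeal (r + 1) M := by
  rw [borderedMinor, ← Matrix.det_submatrix_equiv_self finSumFinEquiv.symm,
    Matrix.submatrix_submatrix]
  exact det_submatrix_mem_minorsIdeal M _ _

theorem map_borderedMinor {R S α β ρ κ : Type*} [CommRing R] [CommRing S] {r : ℕ} (χ : R →+* S)
    (M : Matrix α β R) (σ : Fin r ⊕ ρ → α) (τ : Fin r ⊕ κ → β)
    {A G : Matrix (Fin r) (Fin r) S} {B : Matrix (Fin r) κ S} {C : Matrix ρ (Fin r) S}
    {D : Matrix ρ κ S} (h : (M.map χ).submatrix σ τ = Matrix.fromBlocks A B C D)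
    (hAG : A * G = 1) (i : ρ) (j : κ) :
    χ (borderedMinor M σ τ i j) = A.det * (D - C * G * B) i j := by
  have hsub : (M.map χ).submatrix (σ ∘ Sum.map id fun _ : Fin 1 => i)
      (τ ∘ Sum.map id fun _ : Fin 1 => j) =
      Matrix.fromBlocks A (B.submatrix id fun _ => j) (C.submatrix (fun _ => i) id)
        (D.submatrix (fun _ => i) fun _ => j) := by
    rw [← Matrix.submatrix_submatrix, h]
    ext (a | a) (b | b) <;> rfl
  rw [borderedMinor, RingHom.map_det, RingHom.mapMatrix_apply, ← Matrix.submatrix_map, hsub,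
    det_fromBlocks_of_mul_eq_one A G hAG, Matrix.det_fin_one]
  rfl

/-- The height of a prime avoiding an `r`-minor and containing all `(r+1)`-minors of a generic
matrix. -/
theorem mul_le_height {r a b : ℕ} (p : Ideal (MvPolynomial (Fin m × Fin n) K)) [p.IsPrime]
    (T : Type*) [CommRing T] [IsDomain T] [IsLocalRing T]
    [Algebra (MvPolynomial (Fin m × Fin n) K) T] [IsLocalization.AtPrime T p]
    (hp : minorsIdeal (r + 1) (Matrix.of fun i j =>
      (MvPolynomial.X (i, j) : MvPolynomial (Fin m × Fin n) K)) ≤ p)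
    (σ : Fin r ⊕ Fin a ≃ Fin m) (τ : Fin r ⊕ Fin b ≃ Fin n)
    {A : Matrix (Fin r) (Fin r) T}
    {B : Matrix (Fin r) (Fin b) T}
    {C : Matrix (Fin a) (Fin r) T}
    {D : Matrix (Fin a) (Fin b) T} (hA : IsUnit A.det)
    (hW : ((Matrix.of fun i j =>
      (MvPolynomial.X (i, j) : MvPolynomial (Fin m × Fin n) K)).map
        (algebraMap _ T)).submatrix σ τ = Matrix.fromBlocks A B C D) :
    ((a * b : ℕ) : ℕ∞) ≤ p.height := by
  set X : Matrix (Fin m) (Fin n) (MvPolynomial (Fin m × Fin n) K) :=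
    Matrix.of fun i j => MvPolynomial.X (i, j) with hX
  have hAG : A * A⁻¹ = 1 := Matrix.mul_nonsing_inv A hA
  let c : T →+* MvPolynomial (Fin a × Fin b) T :=
    MvPolynomial.C
  let Y : Matrix (Fin a) (Fin b) (MvPolynomial (Fin a × Fin b) T) :=
    Matrix.of fun i j => MvPolynomial.X (i, j)
  let V := Matrix.fromBlocks (A.map c) (B.map c) (C.map c) ((C * A⁻¹ * B).map c + Y)
  let φ : MvPolynomial (Fin m × Fin n) K →+*
      MvPolynomial (Fin a × Fin b) T :=
    MvPolynomial.eval₂Hom (c.comp ((algebraMap (MvPolynomial (Fin m × Fin n) K) T).comp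
      MvPolynomial.C))
      fun q => V (σ.symm q.1) (τ.symm q.2)
  have hφX : (X.map φ).submatrix σ τ = V := by
    ext1 i j
    simp [X, φ]
  have hAG' : A.map c * A⁻¹.map c = 1 := by
    rw [← Matrix.map_mul, hAG, Matrix.map_one _ c.map_zero c.map_one]
  have hSchur : ∀ i j, (D - C * A⁻¹ * B) i j ∈
      IsLocalRing.maximalIdeal T := by
    intro i j
    rw [← Ideal.unit_mul_mem_iff_mem _ hA, ← map_borderedMinor (algebraMap _ _) X σ τ hW hAG i j,
      IsLocalization.AtPrime.to_map_mem_maximal_iff T p]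
    exact hp (borderedMinor_mem X σ τ i j)
  have hres : (IsLocalRing.residue T).comp
      (MvPolynomial.constantCoeff.comp φ) =
      (IsLocalRing.residue T).comp
        (algebraMap (MvPolynomial (Fin m × Fin n) K) _) := by
    refine MvPolynomial.ringHom_ext (fun k => by simp [φ, c]) ?_
    rintro ⟨i, j⟩
    obtain ⟨i, rfl⟩ := σ.surjective i
    obtain ⟨j, rfl⟩ := τ.surjective j
    have hWij := congrFun (congrFun hW i) j
    change algebraMap (MvPolynomial (Fin m × Fin n) K) T (MvPolynomial.X (σ i, τ j)) = _ at hWij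
    have hVij : φ (MvPolynomial.X (σ i, τ j)) = V i j := congrFun (congrFun hφX i) j
    simp only [RingHom.comp_apply, hWij, hVij]
    rcases i with i | i <;> rcases j with j | j
    · simp only [V, Matrix.fromBlocks_apply₁₁, Matrix.map_apply, c,
        MvPolynomial.constantCoeff_C]
    · simp only [V, Matrix.fromBlocks_apply₁₂, Matrix.map_apply, c,
        MvPolynomial.constantCoeff_C]
    · simp only [V, Matrix.fromBlocks_apply₂₁, Matrix.map_apply, c,
        MvPolynomial.constantCoeff_C]
    · have := (IsLocalRing.residue_eq_zero_iff _).mpr (hSchur i j)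
      rw [Matrix.sub_apply, map_sub, sub_eq_zero] at this
      simp only [V, Matrix.fromBlocks_apply₂₂, Matrix.add_apply, Matrix.map_apply, c, Y,
        Matrix.of_apply, map_add, MvPolynomial.constantCoeff_C, MvPolynomial.constantCoeff_X,
        add_zero, this]
  have := card_le_height φ (fun q => borderedMinor X σ τ q.1 q.2) (fun _ => A.det)
    (fun _ => hA.ne_zero) (fun q => ?_) p (fun f hf => ?_)
  · simpa using this
  · rw [map_borderedMinor φ X σ τ hφX hAG']
    have h1 : (A.map c).det = MvPolynomial.C A.det := (RingHom.map_det c A).symm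
    rw [h1, ← Matrix.map_mul, ← Matrix.map_mul, add_sub_cancel_left]
    rfl
  · have h := RingHom.congr_fun hres f
    simp only [RingHom.comp_apply, hf, map_zero] at h
    rw [eq_comm, IsLocalRing.residue_eq_zero_iff,
      IsLocalization.AtPrime.to_map_mem_maximal_iff T p] at h
    exact h

theorem exists_mu_le_and_le_height {t : ℕ} (p : Ideal (MvPolynomial (Fin m × Fin n) K))
    [p.IsPrime] (hp : minorsIdeal t (Matrix.of fun i j =>
      (MvPolynomial.X (i, j) : MvPolynomial (Fin m × Fin n) K)) ≤ p) :
    ∃ r < t, mu ((minorsIdeal t (Matrix.of fun i j =>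
      (MvPolynomial.X (i, j) : MvPolynomial (Fin m × Fin n) K))).map
        (algebraMap _ (Localization.AtPrime p))) ≤
          (m - r).choose (t - r) * (n - r).choose (t - r) ∧
      (((m - r) * (n - r) : ℕ) : ℕ∞) ≤ p.height := by
  classical
  set X : Matrix (Fin m) (Fin n) (MvPolynomial (Fin m × Fin n) K) :=
    Matrix.of fun i j => MvPolynomial.X (i, j) with hX
  have hex : ∃ k, minorsIdeal k X ≤ p := ⟨t, hp⟩
  obtain ⟨r, hr⟩ : ∃ r, Nat.find hex = r + 1 := by
    refine Nat.exists_eq_succ_of_ne_zero fun h0 => ?_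
    have h := Nat.find_spec hex
    rw [h0, minorsIdeal_zero, top_le_iff] at h
    exact Ideal.IsPrime.ne_top' h
  have hrt : r < t := by
    have := Nat.find_min' hex hp
    omega
  have hr1 : minorsIdeal (r + 1) X ≤ p := hr ▸ Nat.find_spec hex
  have hr0 : ¬ minorsIdeal r X ≤ p := Nat.find_min hex (by omega)
  simp only [minorsIdeal_le_iff, not_forall] at hr0
  obtain ⟨f, g, hf, hg, hfg⟩ := hr0
  obtain ⟨σ, hσ⟩ := exists_equiv_sum_of_injective f hf
  obtain ⟨τ, hτ⟩ := exists_equiv_sum_of_injective g hg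
  let W := (X.map (algebraMap _ (Localization.AtPrime p))).submatrix σ τ
  have hW : W = Matrix.fromBlocks W.toBlocks₁₁ W.toBlocks₁₂ W.toBlocks₂₁ W.toBlocks₂₂ :=
    (Matrix.fromBlocks_toBlocks W).symm
  have hA : IsUnit W.toBlocks₁₁.det := by
    have h : W.toBlocks₁₁ = (X.submatrix f g).map (algebraMap _ (Localization.AtPrime p)) := by
      ext i j
      simp [W, Matrix.toBlocks₁₁, hσ, hτ]
    rw [h, ← RingHom.mapMatrix_apply, ← RingHom.map_det,
      IsLocalization.AtPrime.isUnit_to_map_iff (Localization.AtPrime p) p]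
    exact hfg
  refine ⟨r, hrt, ?_, mul_le_height p (Localization.AtPrime p) hr1 σ τ hA hW⟩
  obtain ⟨k, rfl⟩ := Nat.exists_eq_add_of_le hrt.le
  rw [minorsIdeal_map, ← minorsIdeal_submatrix_equiv _ _ σ τ]
  change mu (minorsIdeal (r + k) W) ≤ _
  rw [hW, minorsIdeal_fromBlocks _ hA, Nat.add_sub_cancel_left]
  exact mu_minorsIdeal_le k _

end Generic

section Arithmetic

theorem Nat.choose_le_choose_of_le_of_add_le {n j k : ℕ} (hjk : j ≤ k) (hkn : k + j ≤ n) :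
    n.choose j ≤ n.choose k := by
  have half : ∀ l, 2 * l ≤ n → j ≤ l → n.choose j ≤ n.choose l := by
    intro l hl hjl
    induction l, hjl using Nat.le_induction with
    | base => exact le_rfl
    | succ l _ ih =>
      exact (ih (by omega)).trans (Nat.choose_le_succ_of_lt_half_left (by omega))
  by_cases h : 2 * k ≤ n
  · exact half k h hjk
  · rw [← Nat.choose_symm (show k ≤ n by omega)]
    exact half (n - k) (by omega) (by omega)

theorem choose_mul_choose_le {t m n r : ℕ} (hrt : r < t) (htm : t ≤ m)
    (h : t = 1 ∨ (t = m ∧ m = n) ∨ (m = n ∧ t = n - 1) ∨ (n = m + 1 ∧ t = m) ∨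
        (n = m + 2 ∧ t = m) ∨ (m = 2 ∧ n = 5 ∧ t = 2)) :
    (m - r).choose (t - r) * (n - r).choose (t - r) ≤ (m - r) * (n - r) := by
  rcases h with rfl | ⟨rfl, rfl⟩ | ⟨rfl, rfl⟩ | ⟨rfl, rfl⟩ | ⟨rfl, rfl⟩ | ⟨rfl, rfl, rfl⟩
  · obtain rfl : r = 0 := by omega
    simp
  · rw [Nat.choose_self]
    have : 0 < t - r := by omega
    nlinarith
  · obtain ⟨b, hb⟩ : ∃ b, m - r = b + 1 := ⟨m - r - 1, by omega⟩
    rw [hb, show m - 1 - r = b by omega, Nat.choose_succ_self_right]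
  · obtain ⟨a, rfl⟩ := Nat.exists_eq_add_of_lt hrt
    rw [show r + a + 1 - r = a + 1 by omega, show r + a + 1 + 1 - r = (a + 1) + 1 by omega,
      Nat.choose_self, Nat.choose_succ_self_right]
    nlinarith
  · obtain ⟨a, rfl⟩ := Nat.exists_eq_add_of_lt hrt
    rw [show r + a + 1 - r = a + 1 by omega, show r + a + 1 + 2 - r = (a + 1) + 2 by omega,
      Nat.choose_self, Nat.choose_symm_add, Nat.choose_two_right, one_mul]
    refine Nat.div_le_of_le_mul ?_
    rw [show a + 1 + 2 - 1 = a + 2 by omega]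
    nlinarith
  · interval_cases r <;> decide

theorem mul_lt_choose_mul_choose {t m n : ℕ} (h1t : 1 ≤ t) (htm : t ≤ m) (hmn : m ≤ n)
    (h : ¬(t = 1 ∨ (t = m ∧ m = n) ∨ (m = n ∧ t = n - 1) ∨ (n = m + 1 ∧ t = m) ∨
        (n = m + 2 ∧ t = m) ∨ (m = 2 ∧ n = 5 ∧ t = 2))) :
    m * n < m.choose t * n.choose t := by
  have htwo : n * (n - 1) = 2 * n.choose 2 := by
    rw [Nat.choose_two_right, Nat.mul_div_cancel' (Nat.even_mul_pred_self n).two_dvd]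
  rcases htm.eq_or_lt with rfl | htm
  · rw [Nat.choose_self, one_mul]
    by_cases ht : t = 2
    · subst ht
      obtain ⟨c, rfl⟩ : ∃ c, n = c + 6 := ⟨n - 6, by omega⟩
      rw [show c + 6 - 1 = c + 5 by omega] at htwo
      nlinarith
    · obtain ⟨c, rfl⟩ : ∃ c, n = c + 6 := ⟨n - 6, by omega⟩
      refine lt_of_lt_of_le ?_ (Nat.choose_le_choose_of_le_of_add_le (j := 3) (k := t)
        (by omega) (by omega))
      have h3 : (c + 6).choose 3 * 3 = (c + 6).choose 2 * (c + 4) :=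
        Nat.choose_succ_right_eq (c + 6) 2
      rw [show c + 6 - 1 = c + 5 by omega] at htwo
      have ht3 : t ≤ c + 3 := by omega
      have h6 : (c + 6).choose 3 * 6 = (c + 6) * ((c + 5) * (c + 4)) := by
        nlinarith
      have hlt : 6 * t < (c + 5) * (c + 4) := by nlinarith
      nlinarith
  · have hm : m ≤ m.choose t := by
      simpa using Nat.choose_le_choose_of_le_of_add_le (n := m) (j := 1) (k := t) h1t htm
    have hn2 : n.choose 2 ≤ n.choose t :=
      Nat.choose_le_choose_of_le_of_add_le (by omega) (by omega)
    obtain ⟨c, rfl⟩ : ∃ c, n = c + 4 := ⟨n - 4, by omega⟩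
    rw [show c + 4 - 1 = c + 3 by omega] at htwo
    have hlt : c + 4 < (c + 4).choose t := by nlinarith
    exact (Nat.mul_lt_mul_of_pos_left hlt (by omega)).trans_le (Nat.mul_le_mul_right _ hm)

end Arithmetic

theorem ker_constantCoeff_eq_span (σ K : Type*) [Field K] :
    RingHom.ker (MvPolynomial.constantCoeff (σ := σ) (R := K)) =
      Ideal.span (Set.range MvPolynomial.X) := by
  refine le_antisymm (fun f hf => ?_) ?_
  · rw [← Set.image_univ, MvPolynomial.mem_ideal_span_X_image]
    intro d hd
    by_contra! h
    obtain rfl : d = 0 := Finsupp.ext fun i => h i (Set.mem_univ i)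
    exact MvPolynomial.mem_support_iff.mp hd hf
  · rw [Ideal.span_le]
    rintro _ ⟨i, rfl⟩
    simp [RingHom.mem_ker]

theorem statement_4 (K : Type*) [Field K]
    (t m n : ℕ) (h1t : 1 ≤ t) (htm : t ≤ m) (hmn : m ≤ n) :
    let X : Matrix (Fin m) (Fin n) (MvPolynomial (Fin m × Fin n) K) :=
      Matrix.of fun i j => MvPolynomial.X (i, j)
    ((∀ s : ℕ, 1 ≤ s → SatisfiesG (minorsIdeal t X) s) ↔
      (t = 1 ∨ (t = m ∧ m = n) ∨ (m = n ∧ t = n - 1) ∨ (n = m + 1 ∧ t = m) ∨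
        (n = m + 2 ∧ t = m) ∨ (m = 2 ∧ n = 5 ∧ t = 2))) := by
  intro X
  constructor
  · intro hG
    by_contra hcond
    have hprime : (RingHom.ker (MvPolynomial.constantCoeff (σ := Fin m × Fin n) (R := K))).IsPrime :=
      RingHom.ker_isPrime _
    set p := RingHom.ker (MvPolynomial.constantCoeff (σ := Fin m × Fin n) (R := K)) with hp
    have hheight : p.height ≤ ((m * n : ℕ) : ℕ∞) := by
      have hne : p ≠ ⊤ := hprime.ne_top
      rw [hp, ker_constantCoeff_eq_span] at hne ⊢
      refine (Ideal.height_le_spanFinrank _ hne).trans ?_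
      have h := Submodule.spanFinrank_span_le_ncard_of_finite
        (R := MvPolynomial (Fin m × Fin n) K)
        (Set.finite_range fun q : Fin m × Fin n => (MvPolynomial.X q : MvPolynomial _ K))
      have hcard := Finite.card_range_le
        fun q : Fin m × Fin n => (MvPolynomial.X q : MvPolynomial _ K)
      rw [Nat.card_coe_set_eq, Nat.card_eq_fintype_card, Fintype.card_prod, Fintype.card_fin,
        Fintype.card_fin] at hcard
      exact_mod_cast h.trans hcard
    have hle : minorsIdeal t X ≤ p := by
      refine (minorsIdeal_antitone X h1t).trans ?_
      rw [minorsIdeal_le_iff]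
      intro f g _ _
      simp [X, hp, RingHom.mem_ker]
    have hdim := IsLocalization.AtPrime.ringKrullDim_eq_height p (Localization.AtPrime p)
    have h := hG (m * n + 1) (by omega) p hprime hle
      (by rw [hdim]; simpa using WithBot.coe_le_coe.mpr hheight)
    rw [hdim] at h
    have hmu := choose_mul_choose_le_mu (t := t) p le_rfl
    have hlt := mul_lt_choose_mul_choose h1t htm hmn hcond
    have hle' : mu ((minorsIdeal t X).map (algebraMap _ (Localization.AtPrime p))) ≤ m * n := by
      exact_mod_cast h.trans (WithBot.coe_le_coe.mpr hheight)
    exact absurd (hmu.trans hle') (not_le.mpr hlt)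
  · intro hcond s _ p hp hle _
    obtain ⟨r, hrt, hmu, hheight⟩ := exists_mu_le_and_le_height p hle
    rw [IsLocalization.AtPrime.ringKrullDim_eq_height p (Localization.AtPrime p)]
    have h : (mu ((minorsIdeal t X).map (algebraMap _ (Localization.AtPrime p))) : ℕ∞) ≤
        p.height :=
      le_trans (by exact_mod_cast hmu.trans (choose_mul_choose_le hrt htm hcond)) hheight
    exact_mod_cast WithBot.coe_le_coe.mpr h
end

section
/- Let R be a Noetherian Cohen–Macaulay ring, let M be a finitely generated R-module of finite projective dimension, let L be an R-module, and let f : M → L be an R-linear map whose kernel equals the torsion submodule of M. Then f is injective if and only if for every prime ideal p of R with ht p > 0 one has pd_{R_p}(M_p) < ht p, where pd denotes projective dimension. -/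
/-- `pdim R M` is the projective dimension of the `R`-module `M`, as an element of `ℕ∞`
(it is `⊤` if `M` has no finite projective resolution). -/
noncomputable def pdim (R : Type*) [Ring R] (M : Type*) [AddCommGroup M] [Module R M] : ℕ∞ :=
  sInf {n : ℕ∞ | ∃ m : ℕ, n = m ∧
    ∃ P : CategoryTheory.ProjectiveResolution (ModuleCat.of R M),
      ∀ i : ℕ, m < i → CategoryTheory.Limits.IsZero (P.complex.X i)}

/-- The depth of a Noetherian local ring: the supremum of lengths of regular sequences
contained in the maximal ideal. -/
noncomputable def ringDepth (R : Type*) [CommRing R] [IsLocalRing R] : ℕ∞ :=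
  sSup {n : ℕ∞ | ∃ rs : List R, n = rs.length ∧
    (∀ r ∈ rs, r ∈ IsLocalRing.maximalIdeal R) ∧ RingTheory.Sequence.IsRegular R rs}

/-- A commutative Noetherian ring is Cohen–Macaulay if each of its localizations at a prime
is a Cohen–Macaulay local ring, i.e. its depth equals its Krull dimension. -/
def IsCohenMacaulayRing (R : Type*) [CommRing R] : Prop :=
  ∀ (p : Ideal R) (hp : p.IsPrime),
    haveI := hp
    (ringDepth (Localization.AtPrime p) : WithBot ℕ∞) = ringKrullDim (Localization.AtPrime p)

open CategoryTheory CategoryTheory.Limits CategoryTheory.Abelian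

universe w v u

section Resolutions

variable {C : Type u} [Category.{v} C] [Abelian C]

/-- An induction principle along short exact sequences with projective middle term: it propagates
a graded property from zero objects to all objects with a projective resolution of finite
length. -/
lemma CategoryTheory.ProjectiveResolution.induction_on_length {Φ : ℕ → C → Prop}
    (zero : ∀ (n : ℕ) (X : C), IsZero X → Φ n X)
    (step : ∀ (n : ℕ) (S : ShortComplex C), S.ShortExact → Projective S.X₂ → Φ n S.X₁ →
      Φ (n + 1) S.X₃)
    {X : C} (P : ProjectiveResolution X) (m : ℕ) (hP : ∀ i, m < i → IsZero (P.complex.X i)) :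
    Φ (m + 1) X := by
  have kernel_step (n : ℕ) (S : ShortComplex C) (hS : S.Exact) (hS₁ : Projective S.X₁)
      (h : Φ n (kernel S.f)) : Φ (n + 1) (kernel S.g) := by
    have := hS.epi_kernelLift
    refine step n (ShortComplex.mk (kernel.ι S.f) (kernel.lift S.g S.f S.zero)
      (by simp [← cancel_mono (kernel.ι S.g)])) ⟨?_⟩ hS₁ h
    refine ShortComplex.exact_of_f_is_kernel _ (KernelFork.IsLimit.ofι' _ _ fun k hk => ?_)
    exact ⟨kernel.lift S.f k (by simpa using congr($hk ≫ kernel.ι S.g)), by simp⟩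
  have kernel_zero (n : ℕ) (S : ShortComplex C) (hS : S.Exact) (hS₁ : IsZero S.X₁) :
      Φ n (kernel S.g) := by
    have := hS.epi_kernelLift
    exact zero _ _ (hS₁.of_epi (kernel.lift S.g S.f S.zero))
  have kernel_d (j : ℕ) : ∀ k, m ≤ j + (k + 1) → Φ j (kernel (P.complex.d (k + 1) k)) := by
    induction j with
    | zero => exact fun k hk => kernel_zero 0 _ (P.exact_succ k) (hP _ (by lia))
    | succ j ih =>
      exact fun k hk => kernel_step j _ (P.exact_succ k) (P.projective _) (ih _ (by lia))
  have kernel_π : Φ m (kernel (P.π.f 0)) := by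
    match m, hP, kernel_d with
    | 0, hP, _ => exact kernel_zero 0 _ P.exact₀ (hP _ (by lia))
    | m + 1, _, kernel_d => exact kernel_step m _ P.exact₀ (P.projective _) (kernel_d m 0 (by lia))
  exact step m (ShortComplex.mk (kernel.ι (P.π.f 0)) (P.π.f 0) (kernel.condition _))
    { exact := ShortComplex.exact_kernel _, epi_g := inferInstanceAs (Epi (P.π.f 0)) }
    (P.projective 0) kernel_π

lemma CategoryTheory.ProjectiveResolution.hasProjectiveDimensionLT {X : C}
    (P : ProjectiveResolution X) (m : ℕ) (hP : ∀ i, m < i → IsZero (P.complex.X i)) :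
    HasProjectiveDimensionLT X (m + 1) :=
  P.induction_on_length (Φ := fun n X => HasProjectiveDimensionLT X n)
    (fun n X hX => by
      have := hX.hasProjectiveDimensionLT_zero
      exact hasProjectiveDimensionLT_of_ge X 0 n n.zero_le)
    (fun n S hS _ h => hS.hasProjectiveDimensionLT_X₃ n h inferInstance) m hP

/-- Splicing a projective resolution of `S.X₁` with a short exact sequence `S` whose middle term
is projective. -/
lemma CategoryTheory.ShortComplex.ShortExact.exists_projectiveResolution {S : ShortComplex C}
    (hS : S.ShortExact) [Projective S.X₂] (Q : ProjectiveResolution S.X₁) (n : ℕ)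
    (hQ : ∀ i, n < i → IsZero (Q.complex.X i)) :
    ∃ P : ProjectiveResolution S.X₃, ∀ i, n + 1 < i → IsZero (P.complex.X i) := by
  have := hS.mono_f
  have := hS.epi_g
  obtain ⟨ε, hdε, hε, hεepi⟩ : ∃ (ε : Q.complex.X 0 ⟶ S.X₁) (h : Q.complex.d 1 0 ≫ ε = 0),
      (ShortComplex.mk _ _ h).Exact ∧ Epi ε :=
    ⟨Q.π.f 0, Q.complex_d_comp_π_f_zero, Q.exact₀, inferInstanceAs (Epi (Q.π.f 0))⟩
  have hw : Q.complex.d 1 0 ≫ ε ≫ S.f = 0 := by rw [reassoc_of% hdε, zero_comp]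
  have hw' : (ε ≫ S.f) ≫ S.g = 0 := by simp
  let D := Q.complex.augment (ε ≫ S.f) hw
  have hD : ∀ n, D.ExactAt (n + 1) := by
    intro n
    rw [HomologicalComplex.exactAt_iff' _ (n + 1 + 1) (n + 1) n (by simp) (by simp)]
    match n with
    | 0 =>
      let φ : ShortComplex.mk _ _ hdε ⟶ ShortComplex.mk _ _ hw :=
        { τ₁ := 𝟙 _, τ₂ := 𝟙 _, τ₃ := S.f }
      exact (ShortComplex.exact_iff_of_epi_of_isIso_of_mono φ).1 hε
    | n + 1 => exact Q.exact_succ n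
  have hD₀ : (ShortComplex.mk (ε ≫ S.f) S.g hw').Exact := by
    let φ : ShortComplex.mk (ε ≫ S.f) S.g hw' ⟶ S := { τ₁ := ε, τ₂ := 𝟙 _, τ₃ := 𝟙 _ }
    exact (ShortComplex.exact_iff_of_epi_of_isIso_of_mono φ).2 hS.exact
  refine ⟨{ complex := D
            projective := fun
              | 0 => inferInstanceAs (Projective S.X₂)
              | i + 1 => Q.projective i
            π := (ChainComplex.toSingle₀Equiv _ _).symm ⟨S.g, hw'⟩
            quasiIso := ⟨fun n => ?_⟩ }, ?_⟩
  · cases n with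
    | zero =>
      rw [ChainComplex.quasiIsoAt₀_iff, ShortComplex.quasiIso_iff_of_zeros']
      · refine (ShortComplex.exact_and_epi_g_iff_of_iso ?_).2 ⟨hD₀, hS.epi_g⟩
        refine ShortComplex.isoMk (Iso.refl _) (Iso.refl _) (Iso.refl _) ?_ ?_
        · exact (Category.id_comp _).trans (Category.comp_id _).symm
        · refine (Category.id_comp _).trans (.trans ?_ (Category.comp_id _).symm)
          exact (ChainComplex.toSingle₀Equiv_symm_apply_f_zero (C := D) S.g hw').symm
      all_goals rfl
    | succ n =>
      rw [quasiIsoAt_iff_exactAt']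
      · exact hD n
      · apply ChainComplex.exactAt_succ_single_obj
  · rintro (_ | i) hi
    · lia
    · exact hQ i (by lia)

lemma CategoryTheory.HasProjectiveDimensionLT.exists_projectiveResolution [EnoughProjectives C]
    (n : ℕ) (X : C) [HasProjectiveDimensionLT X (n + 1)] :
    ∃ P : ProjectiveResolution X, ∀ i, n < i → IsZero (P.complex.X i) := by
  induction n generalizing X with
  | zero =>
    have : Projective X := projective_iff_hasProjectiveDimensionLT_one.2 ‹_›
    refine ⟨ProjectiveResolution.self X, fun i hi => ?_⟩
    exact HomologicalComplex.isZero_single_obj_X _ _ _ _ hi.ne'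
  | succ n ih =>
    have hS : (ShortComplex.mk (kernel.ι (Projective.π X)) (Projective.π X)
        (kernel.condition _)).ShortExact := { exact := ShortComplex.exact_kernel _ }
    have : HasProjectiveDimensionLT (kernel (Projective.π X)) (n + 1) :=
      (hS.hasProjectiveDimensionLT_X₃_iff n (Projective.projective_over X)).1 ‹_›
    obtain ⟨Q, hQ⟩ := ih (kernel (Projective.π X))
    have : Projective (ShortComplex.mk (kernel.ι (Projective.π X)) (Projective.π X)
      (kernel.condition _)).X₂ := Projective.projective_over X
    exact hS.exists_projectiveResolution Q n hQ

end Resolutions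

section ProjectiveDimension

variable {R : Type u} [Ring R] (M : Type v) [AddCommGroup M] [Module R M]

lemma exists_projectiveResolution_of_pdim_ne_top (h : pdim R M ≠ ⊤) :
    ∃ m : ℕ, pdim R M = m ∧ ∃ P : ProjectiveResolution (ModuleCat.of R M),
      ∀ i : ℕ, m < i → IsZero (P.complex.X i) := by
  have hne : {n : ℕ∞ | ∃ m : ℕ, n = m ∧ ∃ P : ProjectiveResolution (ModuleCat.of R M),
      ∀ i : ℕ, m < i → IsZero (P.complex.X i)}.Nonempty := by
    by_contra hempty
    rw [Set.not_nonempty_iff_eq_empty] at hempty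
    exact h (by rw [pdim, hempty, sInf_empty])
  exact csInf_mem hne

lemma pdim_le_of_hasProjectiveDimensionLT [Small.{v} R] (n : ℕ)
    [HasProjectiveDimensionLT (ModuleCat.of R M) (n + 1)] : pdim R M ≤ n :=
  sInf_le ⟨n, rfl, HasProjectiveDimensionLT.exists_projectiveResolution n _⟩

end ProjectiveDimension

section ExtLocal

variable {A : Type u} [CommRing A] [Small.{w} A]

/-- `A` as a module over itself, in the universe `w`. -/
noncomputable abbrev ModuleCat.shrinkSelf (A : Type u) [CommRing A] [Small.{w} A] :
    ModuleCat.{w} A :=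
  ModuleCat.of A (Shrink.{w} A)

namespace CategoryTheory.Abelian.Ext

/-- Scalars annihilating `K` annihilate `Ext K N i`. -/
lemma smul_eq_zero_of_mem_annihilator {K N : ModuleCat.{w} A} {i : ℕ} {a : A}
    (ha : a ∈ Module.annihilator A K) (x : Ext K N i) : a • x = 0 := by
  have h : a • 𝟙 K = 0 := by
    simp [← ModuleCat.lsmul_eq_smul_id, Module.mem_annihilator_iff_lsmul_eq_zero.mp ha]
  have hx : a • x = (Ext.mk₀ (a • 𝟙 K)).comp x (zero_add i) := by simp [Ext.mk₀_smul]
  rw [hx, h, Ext.mk₀_zero, Ext.zero_comp]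

lemma comp_mk₀_ofHom_toSpanSingleton_eq_zero {K F : ModuleCat.{w} A} {I : Ideal A}
    (hK : I ≤ Module.annihilator A K) {i : ℕ} (x : Ext K (ModuleCat.shrinkSelf.{w} A) i)
    {y : F} (hy : y ∈ I • (⊤ : Submodule A F)) :
    x.comp (Ext.mk₀ (ModuleCat.ofHom
      (LinearMap.toSpanSingleton A F y ∘ₗ (Shrink.linearEquiv.{w} A A).toLinearMap)))
      (add_zero i) = 0 := by
  induction hy using Submodule.smul_induction_on' with
  | smul a ha z _ =>
    have : (ModuleCat.ofHom (LinearMap.toSpanSingleton A F (a • z) ∘ₗ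
        (Shrink.linearEquiv.{w} A A).toLinearMap) : ModuleCat.shrinkSelf.{w} A ⟶ F) =
        a • ModuleCat.ofHom (LinearMap.toSpanSingleton A F z ∘ₗ
          (Shrink.linearEquiv.{w} A A).toLinearMap) := by
      ext t
      simp [smul_comm a]
    rw [this, Ext.mk₀_smul, Ext.comp_smul, smul_eq_zero_of_mem_annihilator (hK ha)]
  | add y _ z _ hy hz =>
    have : (ModuleCat.ofHom (LinearMap.toSpanSingleton A F (y + z) ∘ₗ
        (Shrink.linearEquiv.{w} A A).toLinearMap) : ModuleCat.shrinkSelf.{w} A ⟶ F) =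
        ModuleCat.ofHom (LinearMap.toSpanSingleton A F y ∘ₗ
          (Shrink.linearEquiv.{w} A A).toLinearMap) +
        ModuleCat.ofHom (LinearMap.toSpanSingleton A F z ∘ₗ
          (Shrink.linearEquiv.{w} A A).toLinearMap) := by
      ext t
      simp
    rw [this, Ext.mk₀_add, Ext.comp_add, hy, hz, add_zero]

/-- Composition with a map out of a finite free module is computed on a basis. -/
lemma comp_mk₀_eq_sum_basis {K F N : ModuleCat.{w} A} {ι : Type*} [Fintype ι]
    (b : Module.Basis ι A F) (φ : F ⟶ N) {i : ℕ} (x : Ext K F i) :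
    x.comp (Ext.mk₀ φ) (add_zero i) =
      ∑ j, (x.comp (Ext.mk₀ (ModuleCat.ofHom
        ((Shrink.linearEquiv.{w} A A).symm.toLinearMap ∘ₗ b.coord j))) (add_zero i)).comp
        (Ext.mk₀ (ModuleCat.ofHom (LinearMap.toSpanSingleton A N (φ (b j)) ∘ₗ
          (Shrink.linearEquiv.{w} A A).toLinearMap))) (add_zero i) := by
  have hφ : φ = ∑ j, ModuleCat.ofHom
        ((Shrink.linearEquiv.{w} A A).symm.toLinearMap ∘ₗ b.coord j) ≫
        ModuleCat.ofHom (LinearMap.toSpanSingleton A N (φ (b j)) ∘ₗ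
          (Shrink.linearEquiv.{w} A A).toLinearMap) := by
    apply ModuleCat.hom_ext
    refine b.ext fun k => ?_
    classical
    simp [ModuleCat.hom_sum, Finsupp.single_apply]
  conv_lhs => rw [hφ]
  rw [Ext.mk₀_sum, Ext.comp_sum]
  refine Finset.sum_congr rfl fun j _ => ?_
  rw [← Ext.mk₀_comp_mk₀, Ext.comp_assoc_of_third_deg_zero]

lemma comp_mk₀_eq_zero_of_le_smul_top {K F N : ModuleCat.{w} A} [Module.Free A F]
    [Module.Finite A F] {I : Ideal A} (hK : I ≤ Module.annihilator A K) (φ : F ⟶ N)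
    (hφ : ∀ y : F, φ y ∈ I • (⊤ : Submodule A N)) {i : ℕ} (x : Ext K F i) :
    x.comp (Ext.mk₀ φ) (add_zero i) = 0 := by
  rw [comp_mk₀_eq_sum_basis (Module.Free.chooseBasis A F)]
  exact Finset.sum_eq_zero fun j _ => comp_mk₀_ofHom_toSpanSingleton_eq_zero hK _ (hφ _)

lemma subsingleton_of_free {K : ModuleCat.{w} A} (F : ModuleCat.{w} A) [Module.Free A F]
    [Module.Finite A F] {i : ℕ} (h : Subsingleton (Ext K (ModuleCat.shrinkSelf.{w} A) i)) :
    Subsingleton (Ext K F i) := by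
  refine subsingleton_of_forall_eq 0 fun x => ?_
  rw [← Ext.comp_mk₀_id x, comp_mk₀_eq_sum_basis (Module.Free.chooseBasis A F)]
  refine Finset.sum_eq_zero fun j _ => ?_
  rw [Subsingleton.elim (α := Ext K (ModuleCat.shrinkSelf.{w} A) i) (x.comp _ _) 0, Ext.zero_comp]

lemma nontrivial_of_free {K : ModuleCat.{w} A} (F : ModuleCat.{w} A) [Module.Free A F]
    [Nontrivial A] [Nontrivial F] {i : ℕ}
    (h : Nontrivial (Ext K (ModuleCat.shrinkSelf.{w} A) i)) :
    Nontrivial (Ext K F i) := by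
  obtain ⟨x, hx⟩ := exists_ne (0 : Ext K (ModuleCat.shrinkSelf.{w} A) i)
  let b := Module.Free.chooseBasis A F
  have : Nonempty (Module.Free.ChooseBasisIndex A F) := b.index_nonempty
  let j := Classical.arbitrary (Module.Free.ChooseBasisIndex A F)
  let s : ModuleCat.shrinkSelf.{w} A ⟶ F := ModuleCat.ofHom
    (LinearMap.toSpanSingleton A F (b j) ∘ₗ (Shrink.linearEquiv.{w} A A).toLinearMap)
  let r : F ⟶ ModuleCat.shrinkSelf.{w} A := ModuleCat.ofHom
    ((Shrink.linearEquiv.{w} A A).symm.toLinearMap ∘ₗ b.coord j)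
  have hsr : s ≫ r = 𝟙 _ := by
    ext t
    simp [s, r]
  refine ⟨x.comp (Ext.mk₀ s) (add_zero i), 0, fun h0 => hx ?_⟩
  rw [← Ext.comp_mk₀_id x, ← hsr, ← Ext.mk₀_comp_mk₀, ← Ext.comp_assoc_of_third_deg_zero, h0,
    Ext.zero_comp]

end CategoryTheory.Abelian.Ext

end ExtLocal

section MinimalCover

open TensorProduct

variable {A : Type u} [CommRing A] [IsLocalRing A] [Small.{w} A]

/-- A finitely generated module over a local ring has a finite free cover whose kernel is contained
in `𝔪 F`. -/
lemma IsLocalRing.exists_minimal_free_cover (N : Type w) [AddCommGroup N] [Module A N]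
    [Module.Finite A N] :
    ∃ (F : Type w) (_ : AddCommGroup F) (_ : Module A F) (_ : Module.Free A F)
      (_ : Module.Finite A F) (f : F →ₗ[A] N), Function.Surjective f ∧
      LinearMap.ker f ≤ IsLocalRing.maximalIdeal A • (⊤ : Submodule A F) := by
  let k := IsLocalRing.ResidueField A
  let b := Module.finBasis k (k ⊗[A] N)
  obtain ⟨v, hv⟩ := (TensorProduct.mk_surjective A N k Ideal.Quotient.mk_surjective).comp_left b
  replace hv (i) : (1 : k) ⊗ₜ[A] v i = b i := congr_fun hv i
  let c : Module.Basis (Fin (Module.finrank k (k ⊗[A] N))) A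
      (Fin (Module.finrank k (k ⊗[A] N)) → Shrink.{w} A) :=
    .ofEquivFun (LinearEquiv.piCongrRight fun _ => Shrink.linearEquiv.{w} A A)
  refine ⟨_, _, _, .of_basis c, .of_basis c, c.constr A v, ?_, fun x hx => ?_⟩
  · rw [← LinearMap.range_eq_top, Module.Basis.constr_range]
    exact IsLocalRing.span_eq_top_of_tmul_eq_basis v b hv
  · rw [LinearMap.mem_ker, Module.Basis.constr_apply_fintype] at hx
    have hx' : ∑ i, IsLocalRing.residue A (c.equivFun x i) • b i = 0 := by
      have := congr((1 : k) ⊗ₜ[A] $hx)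
      simp only [tmul_sum, tmul_smul, hv, tmul_zero] at this
      rw [← this]
      exact Finset.sum_congr rfl fun i _ => algebraMap_smul k (c.equivFun x i) (b i)
    rw [← c.sum_equivFun x]
    refine sum_mem fun i _ => Submodule.smul_mem_smul ?_ trivial
    rw [← IsLocalRing.residue_eq_zero_iff]
    exact Fintype.linearIndependent_iff.1 b.linearIndependent _ hx' i

end MinimalCover

section AuslanderBuchsbaum

variable {A : Type u} [CommRing A] [IsLocalRing A] [Small.{w} A]

lemma ModuleCat.free_of_hasProjectiveDimensionLT_one (N : ModuleCat.{w} A) [Module.Finite A N]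
    [HasProjectiveDimensionLT N 1] : Module.Free A N := by
  have : Projective N := projective_iff_hasProjectiveDimensionLT_one.2 ‹_›
  have : Module.Projective A N := (IsProjective.iff_projective N).2 this
  exact Module.free_of_flat_of_isLocalRing

variable [IsNoetherianRing A]

/-- A minimal first syzygy, as a short exact sequence of modules. -/
lemma ModuleCat.exists_shortExact_minimal (N : ModuleCat.{w} A) [Module.Finite A N] :
    ∃ S : ShortComplex (ModuleCat.{w} A), S.ShortExact ∧ S.X₃ = N ∧ Module.Finite A S.X₁ ∧
      Module.Free A S.X₂ ∧ Module.Finite A S.X₂ ∧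
      ∀ y, S.f y ∈ IsLocalRing.maximalIdeal A • (⊤ : Submodule A S.X₂) := by
  obtain ⟨F, _, _, _, _, f, hf, hker⟩ := IsLocalRing.exists_minimal_free_cover (A := A) N
  exact ⟨f.shortComplexKer, LinearMap.shortExact_shortComplexKer hf, rfl,
    inferInstanceAs (Module.Finite A (LinearMap.ker f)), inferInstanceAs (Module.Free A F),
    inferInstanceAs (Module.Finite A F), fun y => hker y.2⟩

namespace CategoryTheory.Abelian.Ext

lemma subsingleton_of_hasProjectiveDimensionLT {K : ModuleCat.{w} A} {d : ℕ}
    (hd : ∀ i < d, Subsingleton (Ext K (ModuleCat.shrinkSelf.{w} A) i)) (n : ℕ)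
    (N : ModuleCat.{w} A) [Module.Finite A N] [HasProjectiveDimensionLT N (n + 1)] (i : ℕ)
    (hi : i + n < d) : Subsingleton (Ext K N i) := by
  induction n generalizing N i with
  | zero =>
    have := ModuleCat.free_of_hasProjectiveDimensionLT_one N
    exact subsingleton_of_free N (hd i hi)
  | succ n ih =>
    obtain ⟨S, hS, rfl, _, _, _, -⟩ := ModuleCat.exists_shortExact_minimal N
    have : HasProjectiveDimensionLT S.X₁ (n + 1) :=
      (hS.hasProjectiveDimensionLT_X₃_iff n
        ((IsProjective.iff_projective S.X₂).1 inferInstance)).1 ‹_›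
    have := ih S.X₁ (i + 1) (by lia)
    have := subsingleton_of_free S.X₂ (hd i (by lia))
    refine subsingleton_of_forall_eq 0 fun x => ?_
    obtain ⟨y, rfl⟩ := Ext.covariant_sequence_exact₃ K hS x rfl (Subsingleton.elim _ _)
    rw [Subsingleton.elim y 0, Ext.zero_comp]

/-- The Auslander–Buchsbaum formula, in terms of the first nonvanishing `Ext` group: if `d` is the
depth of `A` and `N` has projective dimension `n`, then the depth of `N` is at most `d - n`. -/
lemma exists_nontrivial_of_hasProjectiveDimensionLT {K : ModuleCat.{w} A}
    (hK : IsLocalRing.maximalIdeal A ≤ Module.annihilator A K) {d : ℕ}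
    (hd : ∀ i < d, Subsingleton (Ext K (ModuleCat.shrinkSelf.{w} A) i))
    (hd' : Nontrivial (Ext K (ModuleCat.shrinkSelf.{w} A) d)) (n : ℕ)
    (N : ModuleCat.{w} A) [Module.Finite A N] [HasProjectiveDimensionLT N (n + 1)]
    (hN : ¬ HasProjectiveDimensionLT N n) : ∃ j, j + n = d ∧ Nontrivial (Ext K N j) := by
  induction n generalizing N with
  | zero =>
    have := ModuleCat.free_of_hasProjectiveDimensionLT_one N
    rw [hasProjectiveDimensionLT_zero_iff_isZero, ModuleCat.isZero_iff_subsingleton,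
      not_subsingleton_iff_nontrivial] at hN
    exact ⟨d, rfl, nontrivial_of_free N hd'⟩
  | succ n ih =>
    obtain ⟨S, hS, rfl, _, _, _, hf⟩ := ModuleCat.exists_shortExact_minimal N
    have hproj : Projective S.X₂ := (IsProjective.iff_projective S.X₂).1 inferInstance
    have : HasProjectiveDimensionLT S.X₁ (n + 1) :=
      (hS.hasProjectiveDimensionLT_X₃_iff n hproj).1 ‹_›
    obtain ⟨j, hj, hnontrivial⟩ := ih S.X₁ fun h =>
      hN (hS.hasProjectiveDimensionLT_X₃ n h inferInstance)
    obtain ⟨x, hx⟩ := exists_ne (0 : Ext K S.X₁ j)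
    have hxf : x.comp (Ext.mk₀ S.f) (add_zero j) = 0 := by
      match n with
      | 0 =>
        have := ModuleCat.free_of_hasProjectiveDimensionLT_one S.X₁
        exact comp_mk₀_eq_zero_of_le_smul_top hK _ hf _
      | n + 1 =>
        have := subsingleton_of_free S.X₂ (hd j (by lia))
        exact Subsingleton.elim _ _
    match j with
    | 0 =>
      have := hS.mono_f
      exact absurd (Ext.postcomp_mk₀_injective_of_mono K S.f (hxf.trans (by simp))) hx
    | j + 1 =>
      obtain ⟨y, rfl⟩ := Ext.covariant_sequence_exact₁ K hS x hxf rfl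
      exact ⟨j, by lia, y, 0, fun hy => hx (by rw [hy, Ext.zero_comp])⟩

end CategoryTheory.Abelian.Ext

end AuslanderBuchsbaum

section Depth

variable {A : Type u} [CommRing A] [IsLocalRing A]

lemma exists_isRegular_of_ringDepth_eq {d : ℕ} (h : ringDepth A = d) :
    ∃ rs : List A, rs.length = d ∧ (∀ r ∈ rs, r ∈ IsLocalRing.maximalIdeal A) ∧
      RingTheory.Sequence.IsRegular A rs := by
  have hne : {n : ℕ∞ | ∃ rs : List A, n = rs.length ∧
      (∀ r ∈ rs, r ∈ IsLocalRing.maximalIdeal A) ∧ RingTheory.Sequence.IsRegular A rs}.Nonempty :=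
    ⟨0, [], by simp, by simp, RingTheory.Sequence.IsRegular.nil A A⟩
  have := hne.to_subtype
  rw [ringDepth] at h
  obtain ⟨rs, hlen, hrs⟩ := ENat.sSup_mem_of_nonempty_of_lt_top (h.trans_lt (ENat.natCast_lt_top d))
  refine ⟨rs, ?_, hrs⟩
  rw [h] at hlen
  exact_mod_cast hlen.symm

lemma length_le_ringDepth {rs : List A} (hmem : ∀ r ∈ rs, r ∈ IsLocalRing.maximalIdeal A)
    (hrs : RingTheory.Sequence.IsRegular A rs) : (rs.length : ℕ∞) ≤ ringDepth A :=
  le_sSup ⟨rs, rfl, hmem, hrs⟩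

variable [Small.{w} A]

/-- The residue field of `A` as an `A`-module, in the universe `w`. -/
noncomputable abbrev ModuleCat.shrinkResidueField (A : Type u) [CommRing A] [IsLocalRing A]
    [Small.{w} A] : ModuleCat.{w} A :=
  ModuleCat.of A (Shrink.{w} (A ⧸ IsLocalRing.maximalIdeal A))

lemma annihilator_shrinkResidueField :
    Module.annihilator A (ModuleCat.shrinkResidueField.{w} A) = IsLocalRing.maximalIdeal A := by
  rw [(Shrink.linearEquiv.{w} A _).annihilator_eq, Ideal.annihilator_quotient]

variable [IsNoetherianRing A]

/-- The Rees theorem for the ring itself: regular sequences in the maximal ideal are detected by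
`Ext` groups out of the residue field. -/
lemma exists_isRegular_iff_subsingleton_ext (n : ℕ) :
    (∃ rs : List A, rs.length = n ∧ (∀ r ∈ rs, r ∈ IsLocalRing.maximalIdeal A) ∧
      RingTheory.Sequence.IsRegular A rs) ↔
    ∀ i < n, Subsingleton (Ext (ModuleCat.shrinkResidueField.{w} A)
      (ModuleCat.shrinkSelf.{w} A) i) := by
  have : Module.Finite A (ModuleCat.shrinkSelf.{w} A) :=
    .equiv (Shrink.linearEquiv.{w} A A).symm
  have : Nontrivial (ModuleCat.shrinkSelf.{w} A) := (Shrink.linearEquiv.{w} A A).nontrivial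
  have hlt : IsLocalRing.maximalIdeal A • (⊤ : Submodule A (ModuleCat.shrinkSelf.{w} A)) < ⊤ := by
    refine lt_top_iff_ne_top.2 (Ne.symm ?_)
    exact Submodule.top_ne_ideal_smul_of_le_jacobson_annihilator
      (IsLocalRing.maximalIdeal_le_jacobson _)
  have := (ModuleCat.exists_isRegular_tfae.{w} (IsLocalRing.maximalIdeal A) n
    (ModuleCat.shrinkSelf.{w} A) hlt).out 3 1
  rw [← this]
  simp only [(Shrink.linearEquiv.{w} A A).isRegular_congr]

lemma subsingleton_ext_of_lt_ringDepth {d : ℕ} (h : ringDepth A = d) :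
    ∀ i < d, Subsingleton (Ext (ModuleCat.shrinkResidueField.{w} A)
      (ModuleCat.shrinkSelf.{w} A) i) :=
  (exists_isRegular_iff_subsingleton_ext d).1 (exists_isRegular_of_ringDepth_eq h)

lemma nontrivial_ext_ringDepth {d : ℕ} (h : ringDepth A = d) :
    Nontrivial (Ext (ModuleCat.shrinkResidueField.{w} A) (ModuleCat.shrinkSelf.{w} A) d) := by
  rw [← not_subsingleton_iff_nontrivial]
  intro hd
  obtain ⟨rs, hlen, hmem, hrs⟩ := (exists_isRegular_iff_subsingleton_ext.{w} (A := A) (d + 1)).2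
    fun i hi => (Nat.lt_succ_iff_lt_or_eq.1 hi).elim
      (subsingleton_ext_of_lt_ringDepth h i) fun hid => hid ▸ hd
  have := length_le_ringDepth hmem hrs
  rw [h, hlen] at this
  exact absurd (by exact_mod_cast this) (Nat.not_succ_le_self d)

lemma subsingleton_ext_zero_iff (N : ModuleCat.{w} A) [Module.Finite A N] :
    Subsingleton (Ext (ModuleCat.shrinkResidueField.{w} A) N 0) ↔
      ∃ x ∈ IsLocalRing.maximalIdeal A, IsSMulRegular N x := by
  have : Module.Finite A (ModuleCat.shrinkResidueField.{w} A) :=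
    .equiv (Shrink.linearEquiv.{w} A _).symm
  rw [(Ext.addEquiv₀.trans ModuleCat.homAddEquiv).toEquiv.subsingleton_congr,
    IsSMulRegular.subsingleton_linearMap_iff, annihilator_shrinkResidueField]

lemma exists_isSMulRegular_of_hasProjectiveDimensionLT {d : ℕ} (h : ringDepth A = d)
    (N : ModuleCat.{w} A) [Module.Finite A N] (n : ℕ) (hn : n < d)
    [HasProjectiveDimensionLT N (n + 1)] :
    ∃ x ∈ IsLocalRing.maximalIdeal A, IsSMulRegular N x :=
  (subsingleton_ext_zero_iff N).1 <| Ext.subsingleton_of_hasProjectiveDimensionLT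
    (subsingleton_ext_of_lt_ringDepth h) n N 0 (by lia)

lemma hasProjectiveDimensionLT_of_isSMulRegular {d : ℕ} (h : ringDepth A = d)
    (N : ModuleCat.{w} A) [Module.Finite A N] {x : A} (hx : x ∈ IsLocalRing.maximalIdeal A)
    (hxN : IsSMulRegular N x) (m : ℕ) (hm : HasProjectiveDimensionLT N m) :
    HasProjectiveDimensionLT N d := by
  induction m with
  | zero => exact hasProjectiveDimensionLT_of_ge N 0 d d.zero_le
  | succ n ih =>
    by_cases hn : HasProjectiveDimensionLT N n
    · exact ih hn
    · obtain ⟨j, hj, hnontrivial⟩ := Ext.exists_nontrivial_of_hasProjectiveDimensionLT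
        annihilator_shrinkResidueField.ge (subsingleton_ext_of_lt_ringDepth h)
        (nontrivial_ext_ringDepth h) n N hn
      match j with
      | 0 =>
        exact absurd ((subsingleton_ext_zero_iff N).2 ⟨x, hx, hxN⟩)
          (not_subsingleton_iff_nontrivial.2 hnontrivial)
      | j + 1 => exact hasProjectiveDimensionLT_of_ge N (n + 1) d (by lia)

end Depth

section Smallness

lemma small_quotient_ideal_pow {A : Type u} [CommRing A] [IsNoetherianRing A] (I : Ideal A)
    [Small.{v} (A ⧸ I)] (n : ℕ) : Small.{v} (A ⧸ I ^ n) := by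
  induction n with
  | zero =>
    have : Subsingleton (A ⧸ I ^ 0) := by
      rw [Ideal.Quotient.subsingleton_iff, pow_zero, Ideal.one_eq_top]
    infer_instance
  | succ n ih =>
    obtain ⟨k, x, hx⟩ := Submodule.fg_iff_exists_fin_generating_family.1
      (IsNoetherian.noetherian I)
    have hxI (i : Fin k) : x i ∈ I := hx ▸ Submodule.subset_span (Set.mem_range_self i)
    let φ : (A ⧸ I) × (Fin k → A ⧸ I ^ n) → A ⧸ I ^ (n + 1) := fun t =>
      Ideal.Quotient.mk _ (Quotient.out t.1 + ∑ i, Quotient.out (t.2 i) * x i)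
    refine small_of_surjective (f := φ) fun y => ?_
    obtain ⟨a, rfl⟩ := Ideal.Quotient.mk_surjective y
    have ha : a - Quotient.out (Ideal.Quotient.mk I a) ∈ I := by
      rw [← Ideal.Quotient.eq]
      exact (Ideal.Quotient.mk_out _).symm
    obtain ⟨c, hc⟩ := (Submodule.mem_span_range_iff_exists_fun A).1 (hx.ge ha)
    refine ⟨(Ideal.Quotient.mk I a, fun i => Ideal.Quotient.mk _ (c i)), ?_⟩
    refine (Ideal.Quotient.eq.2 ?_).symm
    rw [← sub_sub, ← hc, ← Finset.sum_sub_distrib]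
    refine sum_mem fun i _ => ?_
    rw [smul_eq_mul, ← sub_mul, pow_succ]
    refine Ideal.mul_mem_mul ?_ (hxI i)
    rw [← Ideal.Quotient.eq]
    exact (Ideal.Quotient.mk_out _).symm

/-- A Noetherian local ring is as small as its residue field. -/
lemma IsLocalRing.small_of_small_residueField (A : Type u) [CommRing A] [IsNoetherianRing A]
    [IsLocalRing A] [Small.{v} (IsLocalRing.ResidueField A)] : Small.{v} A := by
  have : Small.{v} (A ⧸ IsLocalRing.maximalIdeal A) :=
    inferInstanceAs (Small.{v} (IsLocalRing.ResidueField A))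
  have (n : ℕ) := small_quotient_ideal_pow.{v} (IsLocalRing.maximalIdeal A) n
  let φ : A → (n : ℕ) → A ⧸ IsLocalRing.maximalIdeal A ^ n := fun a n => Ideal.Quotient.mk _ a
  refine small_of_injective (f := φ) fun a b hab => ?_
  rw [← sub_eq_zero, ← Ideal.mem_bot,
    ← Ideal.iInf_pow_eq_bot_of_isLocalRing _ (IsLocalRing.maximalIdeal.isMaximal A).ne_top]
  exact (Submodule.mem_iInf _).2 fun n => Ideal.Quotient.eq.1 (congr_fun hab n)

lemma small_localization_of_mem_support {R : Type u} [CommRing R] [IsNoetherianRing R]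
    {M : Type v} [AddCommGroup M] [Module R M] (p : PrimeSpectrum R)
    (hp : p ∈ Module.support R M) : Small.{v} (Localization.AtPrime p.asIdeal) := by
  obtain ⟨m, hm⟩ := Module.mem_support_iff'.1 hp
  have : Small.{v} (R ⧸ p.asIdeal) := by
    let φ : R ⧸ p.asIdeal → M := fun t => (Quotient.out t : R) • m
    refine small_of_injective (f := φ) fun s t hst => ?_
    rw [← Ideal.Quotient.mk_out s, ← Ideal.Quotient.mk_out t, Ideal.Quotient.eq]
    by_contra h
    exact hm _ h (by rw [sub_smul, sub_eq_zero]; exact hst)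
  have : Small.{v} (IsLocalRing.ResidueField (Localization.AtPrime p.asIdeal)) :=
    small_of_surjective (f := fun t : (R ⧸ p.asIdeal) × (R ⧸ p.asIdeal) =>
      algebraMap _ p.asIdeal.ResidueField t.1 / algebraMap _ p.asIdeal.ResidueField t.2)
      fun y => by
        obtain ⟨a, b, -, h⟩ := IsFractionRing.div_surjective (A := R ⧸ p.asIdeal) y
        exact ⟨(a, b), h⟩
  exact IsLocalRing.small_of_small_residueField _

end Smallness

section Localization

variable {R : Type u} [CommRing R] (S : Submonoid R)

lemma projective_localizedModule [Small.{v} (Localization S)] (P : ModuleCat.{v} R)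
    [Projective P] : Module.Projective (Localization S) (LocalizedModule S P) := by
  let ι := LocalizedModule.mkLinearMap S P
  let π : (P →₀ Localization S) →ₗ[Localization S] LocalizedModule S P :=
    Finsupp.linearCombination (Localization S) ι
  have hπ : Function.Surjective π := by
    intro y
    induction y using LocalizedModule.induction_on with
    | h x s =>
      refine ⟨Finsupp.single x (Localization.mk 1 s), ?_⟩
      simp [π, ι, LocalizedModule.mk_smul_mk]
  have : Small.{v} (LocalizedModule S P) :=
    small_of_surjective (f := fun t : P × Localization S => t.2 • ι t.1) fun y => by
      induction y using LocalizedModule.induction_on with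
      | h x s => exact ⟨(x, Localization.mk 1 s), by simp [ι, LocalizedModule.mk_smul_mk]⟩
  let e : (P →₀ Shrink.{v} (Localization S)) ≃ₗ[R] (P →₀ Localization S) :=
    Finsupp.mapRange.linearEquiv (Shrink.linearEquiv.{v} R (Localization S))
  let e' := Shrink.linearEquiv.{v} R (LocalizedModule S P)
  let q : ModuleCat.of R (P →₀ Shrink.{v} (Localization S)) ⟶
      ModuleCat.of R (Shrink.{v} (LocalizedModule S P)) :=
    ModuleCat.ofHom (e'.symm.toLinearMap ∘ₗ π.restrictScalars R ∘ₗ e.toLinearMap)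
  have : Epi q := by
    rw [ModuleCat.epi_iff_surjective]
    exact e'.symm.surjective.comp (hπ.comp e.surjective)
  let g : P ⟶ ModuleCat.of R (Shrink.{v} (LocalizedModule S P)) :=
    ModuleCat.ofHom (e'.symm.toLinearMap ∘ₗ ι)
  let h : P →ₗ[R] (P →₀ Localization S) := e.toLinearMap ∘ₗ (Projective.factorThru g q).hom
  have hh (x : P) : π (h x) = ι x := by
    have := congr($(Projective.factorThru_comp g q) x)
    exact e'.symm.injective this
  have hunit (s : S) : IsUnit (algebraMap R (Module.End R (P →₀ Localization S)) s) :=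
    IsLocalizedModule.map_units (Finsupp.mapRange.linearMap (α := P)
      (Algebra.linearMap R (Localization S))) s
  let k := (IsLocalizedModule.lift S ι h hunit).extendScalarsOfIsLocalization S (Localization S)
  refine Module.Projective.of_split k π (LinearMap.ext fun y => ?_)
  have : (π ∘ₗ k).restrictScalars R = LinearMap.id := by
    refine IsLocalizedModule.linearMap_ext S ι ι (LinearMap.ext fun x => ?_)
    simpa [k] using hh x
  exact congr($this y)

/-- The localization of a short complex of modules, in a possibly larger universe. -/
noncomputable def CategoryTheory.ShortComplex.localizedModule
    (T : ShortComplex (ModuleCat.{v} R)) :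
    ShortComplex (ModuleCat.{max u v} (Localization S)) where
  X₁ := ModuleCat.of _ (LocalizedModule S T.X₁)
  X₂ := ModuleCat.of _ (LocalizedModule S T.X₂)
  X₃ := ModuleCat.of _ (LocalizedModule S T.X₃)
  f := ModuleCat.ofHom (LocalizedModule.map S T.f.hom)
  g := ModuleCat.ofHom (LocalizedModule.map S T.g.hom)
  zero := by
    ext y
    induction y using LocalizedModule.induction_on with
    | h x s => simp [LocalizedModule.map_mk]

lemma CategoryTheory.ShortComplex.ShortExact.localizedModule {T : ShortComplex (ModuleCat.{v} R)}
    (hT : T.ShortExact) : (T.localizedModule S).ShortExact := by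
  refine ModuleCat.shortComplex_shortExact _ ?_ ?_ ?_
  · exact LocalizedModule.map_exact S T.f.hom T.g.hom
      ((ShortComplex.ShortExact.moduleCat_exact_iff_function_exact T).1 hT.exact)
  · exact IsLocalizedModule.map_injective S (LocalizedModule.mkLinearMap S T.X₁)
      (LocalizedModule.mkLinearMap S T.X₂) T.f.hom hT.moduleCat_injective_f
  · exact IsLocalizedModule.map_surjective S (LocalizedModule.mkLinearMap S T.X₂)
      (LocalizedModule.mkLinearMap S T.X₃) T.g.hom hT.moduleCat_surjective_g

lemma hasProjectiveDimensionLT_localizedModule [Small.{v} (Localization S)] {X : ModuleCat.{v} R}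
    (P : ProjectiveResolution X) (m : ℕ) (hP : ∀ i, m < i → IsZero (P.complex.X i)) :
    HasProjectiveDimensionLT (ModuleCat.of (Localization S) (LocalizedModule S X)) (m + 1) := by
  refine P.induction_on_length (Φ := fun n (X : ModuleCat.{v} R) => HasProjectiveDimensionLT
    (ModuleCat.of (Localization S) (LocalizedModule S X)) n) (fun n X hX => ?_)
    (fun n T hT _ h => ?_) m hP
  · have : Subsingleton X := ModuleCat.isZero_iff_subsingleton.1 hX
    have : Subsingleton (LocalizedModule S X) := inferInstance
    have := (ModuleCat.isZero_of_subsingleton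
      (ModuleCat.of (Localization S) (LocalizedModule S X))).hasProjectiveDimensionLT_zero
    exact hasProjectiveDimensionLT_of_ge _ 0 n n.zero_le
  · have := projective_localizedModule S T.X₂
    have : Projective (T.localizedModule S).X₂ := (IsProjective.iff_projective _).1 this
    exact (hT.localizedModule S).hasProjectiveDimensionLT_X₃ n h inferInstance

end Localization

section CohenMacaulay

open nonZeroDivisors

variable {R : Type u} [CommRing R] [IsNoetherianRing R]

lemma not_isSMulRegular_of_mem_associatedPrimes {N : Type v} [AddCommGroup N] [Module R N]
    {p : Ideal R}
    (hp : p ∈ associatedPrimes R N) {x : R} (hx : x ∈ p) : ¬ IsSMulRegular N x := by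
  have : x ∈ ⋃ q ∈ associatedPrimes R N, (q : Set R) := Set.mem_biUnion hp hx
  rwa [biUnion_associatedPrimes_eq_compl_regular] at this

lemma IsCohenMacaulayRing.exists_ringDepth_eq (hCM : IsCohenMacaulayRing R)
    (p : PrimeSpectrum R) :
    ∃ d : ℕ, ringDepth (Localization.AtPrime p.asIdeal) = d ∧ Order.height p = d := by
  have h := hCM p.asIdeal p.isPrime
  rw [IsLocalization.AtPrime.ringKrullDim_eq_height p.asIdeal, WithBot.coe_inj,
    PrimeSpectrum.height_eq_orderHeight] at h
  have hfin : Order.height p ≠ ⊤ := by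
    rw [← PrimeSpectrum.height_eq_orderHeight]
    exact Ideal.height_ne_top p.isPrime.ne_top
  obtain ⟨d, hd⟩ := ENat.ne_top_iff_exists.1 hfin
  exact ⟨d, h.trans hd.symm, hd.symm⟩

/-- A Cohen–Macaulay ring has no embedded primes. -/
lemma IsCohenMacaulayRing.height_eq_zero_of_mem_associatedPrimes (hCM : IsCohenMacaulayRing R)
    (q : PrimeSpectrum R) (hq : q.asIdeal ∈ associatedPrimes R R) : Order.height q = 0 := by
  obtain ⟨d, hd, hht⟩ := hCM.exists_ringDepth_eq q
  obtain ⟨rs, hlen, hmem, hrs⟩ := exists_isRegular_of_ringDepth_eq hd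
  match rs with
  | [] => rw [hht, ← hlen]; simp
  | a :: rs =>
    have hass : IsLocalRing.maximalIdeal (Localization.AtPrime q.asIdeal) ∈
        associatedPrimes (Localization.AtPrime q.asIdeal) (Localization.AtPrime q.asIdeal) := by
      open Module.associatedPrimes in
      apply mem_associatedPrimes_of_comap_mem_associatedPrimes_of_isLocalizedModule
        q.asIdeal.primeCompl (Algebra.linearMap R (Localization.AtPrime q.asIdeal))
      simpa [Localization.AtPrime.under_maximalIdeal] using hq
    rw [RingTheory.Sequence.isRegular_cons_iff] at hrs
    exact absurd hrs.1 (not_isSMulRegular_of_mem_associatedPrimes hass (hmem a (by simp)))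

lemma IsCohenMacaulayRing.exists_mem_nonZeroDivisors (hCM : IsCohenMacaulayRing R)
    (p : PrimeSpectrum R) (hp : 0 < Order.height p) : ∃ x ∈ p.asIdeal, x ∈ R⁰ := by
  by_contra! h
  obtain ⟨q, hq, hpq⟩ := (p.asIdeal.subset_union_prime_finite (associatedPrimes.finite R R)
    (f := id) 0 0 fun _ h _ _ => h.isPrime).1 <| by
      simp_rw [id, biUnion_associatedPrimes_eq_compl_nonZeroDivisors]
      exact h
  have := hCM.height_eq_zero_of_mem_associatedPrimes ⟨q, hq.isPrime⟩ hq
  have hle : Order.height p ≤ Order.height (⟨q, hq.isPrime⟩ : PrimeSpectrum R) :=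
    Order.height_mono hpq
  exact hp.ne' (le_antisymm (hle.trans this.le) bot_le)

end CohenMacaulay

section Torsion

open nonZeroDivisors

variable {R : Type u} [CommRing R] [IsNoetherianRing R] (M : Type v) [AddCommGroup M] [Module R M]
  [Module.Finite R M]

lemma IsCohenMacaulayRing.pdim_lt_height (hCM : IsCohenMacaulayRing R) (hpd : pdim R M ≠ ⊤)
    (htors : Submodule.torsion R M = ⊥) (p : PrimeSpectrum R) (hp : 0 < Order.height p) :
    pdim (Localization.AtPrime p.asIdeal) (LocalizedModule p.asIdeal.primeCompl M)
      < Order.height p := by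
  have : Small.{max u v} (Localization.AtPrime p.asIdeal) := small_max _
  let N := ModuleCat.of (Localization.AtPrime p.asIdeal) (LocalizedModule p.asIdeal.primeCompl M)
  obtain ⟨d, hd, hht⟩ := hCM.exists_ringDepth_eq p
  have hfin : ∃ m, HasProjectiveDimensionLT N m := by
    by_cases hsupp : p ∈ Module.support R M
    · have := small_localization_of_mem_support p hsupp
      obtain ⟨m, -, P, hP⟩ := exists_projectiveResolution_of_pdim_ne_top M hpd
      exact ⟨m + 1, hasProjectiveDimensionLT_localizedModule p.asIdeal.primeCompl P m hP⟩
    · have : Subsingleton N := Module.notMem_support_iff.1 hsupp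
      exact ⟨0, (ModuleCat.isZero_of_subsingleton N).hasProjectiveDimensionLT_zero⟩
  obtain ⟨m, hm⟩ := hfin
  obtain ⟨x, hxp, hx⟩ := hCM.exists_mem_nonZeroDivisors p hp
  have hxM : IsSMulRegular M x := by
    refine isSMulRegular_iff_right_eq_zero_of_smul.2 fun y hy => ?_
    rw [← Submodule.mem_bot R, ← htors]
    exact ⟨⟨x, hx⟩, hy⟩
  have hN := hasProjectiveDimensionLT_of_isSMulRegular hd N
    (x := algebraMap R _ x) ((IsLocalization.AtPrime.to_map_mem_maximal_iff _ p.asIdeal x).2 hxp)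
    (hxM.of_isLocalizedModule (Localization.AtPrime p.asIdeal) p.asIdeal.primeCompl
      (LocalizedModule.mkLinearMap p.asIdeal.primeCompl M)) m hm
  rw [hht] at hp ⊢
  match d with
  | 0 => simp at hp
  | d + 1 =>
    exact (pdim_le_of_hasProjectiveDimensionLT _ d).trans_lt (by exact_mod_cast d.lt_succ_self)

lemma IsCohenMacaulayRing.torsion_eq_bot (hCM : IsCohenMacaulayRing R)
    (h : ∀ p : PrimeSpectrum R, 0 < Order.height p →
      pdim (Localization.AtPrime p.asIdeal) (LocalizedModule p.asIdeal.primeCompl M)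
        < Order.height p) :
    Submodule.torsion R M = ⊥ := by
  refine (Submodule.eq_bot_iff _).2 fun x ⟨⟨a, ha⟩, hax⟩ => ?_
  by_contra hx
  obtain ⟨P, hP, hle⟩ := exists_le_isAssociatedPrime_of_isNoetherianRing R x hx
  have haP : a ∈ P := hle (Submodule.mem_colon_singleton.2 hax)
  obtain ⟨p, rfl⟩ : ∃ p : PrimeSpectrum R, p.asIdeal = P := ⟨⟨P, hP.isPrime⟩, rfl⟩
  have hp : 0 < Order.height p := by
    rw [← PrimeSpectrum.height_eq_orderHeight, pos_iff_ne_zero, Ne, Ideal.height_eq_zero_iff]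
    exact fun hmin =>
      Set.disjoint_left.1 (Ideal.disjoint_nonZeroDivisors_of_mem_minimalPrimes hmin) haP ha
  have : Small.{max u v} (Localization.AtPrime p.asIdeal) := small_max _
  obtain ⟨d, hd, hht⟩ := hCM.exists_ringDepth_eq p
  have hlt := h p hp
  obtain ⟨n, hn, Q, hQ⟩ := exists_projectiveResolution_of_pdim_ne_top _ hlt.ne_top
  rw [hn, hht] at hlt
  have := Q.hasProjectiveDimensionLT n hQ
  obtain ⟨y, hy, hyreg⟩ := exists_isSMulRegular_of_hasProjectiveDimensionLT hd
    (ModuleCat.of _ (LocalizedModule p.asIdeal.primeCompl M)) n (by exact_mod_cast hlt)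
  exact not_isSMulRegular_of_mem_associatedPrimes
    (Module.associatedPrimes.mem_associatedPrimes_atPrime_of_mem_associatedPrimes hP) hy hyreg

end Torsion

theorem statement_7 {R : Type*} [CommRing R] [IsNoetherianRing R]
    (hCM : IsCohenMacaulayRing R)
    (M : Type*) [AddCommGroup M] [Module R M] [Module.Finite R M]
    (hpd : pdim R M ≠ ⊤)
    (L : Type*) [AddCommGroup L] [Module R L]
    (f : M →ₗ[R] L) (hker : LinearMap.ker f = Submodule.torsion R M) :
    Function.Injective f ↔
      ∀ p : PrimeSpectrum R, 0 < Order.height p →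
        pdim (Localization.AtPrime p.asIdeal) (LocalizedModule p.asIdeal.primeCompl M)
          < Order.height p := by
  rw [← LinearMap.ker_eq_bot, hker]
  exact ⟨hCM.pdim_lt_height M hpd, hCM.torsion_eq_bot M⟩
end
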